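/- Suppose there exist T > 0 and δ ∈ (0.00162, 0.22176) such that the prior density π_τ vanishes on (0,T) and ∫_T^∞ u^{δ/2} π_τ(u) du < ∞. Then there exist δ₀, δ₁ ∈ (0,1), γ* ∈ (0,1) and b* < ∞ such that for every x ∈ (0,∞)^p, ∫_{(0,∞)^p} k(x, x′) V(x′) dx′ ≤ γ* V(x) + b*, where V(x) = Σ_{j=1}^p x_j^{δ₀/2} + Σ_{j=1}^p x_j^{−δ₁/2}. -/

import Mathlib

open Matrix MeasureTheory

/-- The Inverse-Gamma(α, β) density `u ↦ β^α Γ(α)⁻¹ u^{−α−1} e^{−β/u}`. -/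
noncomputable def igDens (α β u : ℝ) : ℝ :=
  β ^ α * (Real.Gamma α)⁻¹ * u ^ (-α - 1) * Real.exp (-β / u)

/-- `A(t, x) = XᵀX + (t Λ_x)⁻¹` with `Λ_x = diag(x₁, …, x_p)`. -/
noncomputable def hsA (n p : ℕ) (X : Matrix (Fin n) (Fin p) ℝ)
    (t : ℝ) (x : Fin p → ℝ) : Matrix (Fin p) (Fin p) ℝ :=
  X.transpose * X + (t • Matrix.diagonal x)⁻¹

/-- `r(t, x) = yᵀ(I − X A(t,x)⁻¹ Xᵀ)y/2 + b`. -/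
noncomputable def hsR (n p : ℕ) (X : Matrix (Fin n) (Fin p) ℝ)
    (y : Fin n → ℝ) (b t : ℝ) (x : Fin p → ℝ) : ℝ :=
  y ⬝ᵥ ((1 - X * (hsA n p X t x)⁻¹ * X.transpose).mulVec y) / 2 + b

/-- The `N_p(μ, s A⁻¹)` density at `β`:
`(2π s)^{−p/2} det(A)^{1/2} exp(−(β−μ)ᵀA(β−μ)/(2s))`. -/
noncomputable def gaussDens (p : ℕ) (A : Matrix (Fin p) (Fin p) ℝ)
    (μ : Fin p → ℝ) (s : ℝ) (β : Fin p → ℝ) : ℝ :=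
  (2 * Real.pi * s) ^ (-(p : ℝ) / 2) * A.det ^ ((1 : ℝ) / 2) *
    Real.exp (-((β - μ) ⬝ᵥ A.mulVec (β - μ)) / (2 * s))

/-- The unnormalized conditional posterior density of `τ² = t` given the
squared local shrinkage parameters `x`:
`f_x(t) = r(t,x)^{−(a+n/2)} det(I + t XᵀX Λ_x)^{−1/2} π_τ(t)`. -/
noncomputable def hsTauDens (n p : ℕ) (X : Matrix (Fin n) (Fin p) ℝ)
    (y : Fin n → ℝ) (a b : ℝ) (πτ : ℝ → ℝ) (x : Fin p → ℝ) (t : ℝ) : ℝ :=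
  hsR n p X y b t x ^ (-(a + (n : ℝ) / 2)) *
    ((1 + t • (X.transpose * X * Matrix.diagonal x)).det) ^ (-(1 / 2 : ℝ)) *
    πτ t

/-- The Markov transition density of the marginal λ-chain of the two-block
Horseshoe Gibbs sampler, as an iterated integral over `t ∈ (0,∞)`,
`ν ∈ (0,∞)^p`, `σ² = s ∈ (0,∞)`, `β ∈ ℝ^p`. -/
noncomputable def hsMTD (n p : ℕ) (X : Matrix (Fin n) (Fin p) ℝ)
    (y : Fin n → ℝ) (a b : ℝ) (πτ : ℝ → ℝ) (x x' : Fin p → ℝ) : ℝ :=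
  ∫ t in Set.Ioi (0 : ℝ),
    (∫ ν in Set.univ.pi (fun _ : Fin p => Set.Ioi (0 : ℝ)),
      (∫ s in Set.Ioi (0 : ℝ),
        (∫ β : Fin p → ℝ,
          (∏ j, igDens 1 ((ν j)⁻¹ + (β j) ^ 2 / (2 * s * t)) (x' j)) *
            gaussDens p (hsA n p X t x)
              ((hsA n p X t x)⁻¹.mulVec (X.transpose.mulVec y)) s β) *
          igDens (a + (n : ℝ) / 2) (hsR n p X y b t x) s) *
        ∏ j, igDens 1 (1 + (x j)⁻¹) (ν j)) *
    (hsTauDens n p X y a b πτ x t /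
      ∫ u in Set.Ioi (0 : ℝ), hsTauDens n p X y a b πτ x u)


lemma aux_lprod {p : ℕ} (μ : Fin p → Measure ℝ) [∀ i, SigmaFinite (μ i)]
    (f : Fin p → ℝ → ENNReal) (hf : ∀ i, Measurable (f i)) :
    ∫⁻ x, ∏ i, f i (x i) ∂Measure.pi μ = ∏ i, ∫⁻ u, f i u ∂(μ i) := by
  induction p with
  | zero => simp
  | succ k ih =>
    have h := (measurePreserving_piFinSuccAbove μ 0).symm
    rw [← h.lintegral_comp_emb (MeasurableEquiv.measurableEmbedding _)]
    simp only [Fin.prod_univ_succ]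
    have h2 : ∀ a : ℝ × (Fin k → ℝ), (f 0 ((MeasurableEquiv.piFinSuccAbove (fun _ => ℝ) 0).symm a 0) *
        ∏ i : Fin k, f i.succ ((MeasurableEquiv.piFinSuccAbove (fun _ => ℝ) 0).symm a i.succ)) =
        f 0 a.1 * ∏ i : Fin k, f i.succ (a.2 i) := by
      intro a
      rfl
    simp only [h2]
    have h3 := lintegral_prod_mul (μ := μ 0) (ν := Measure.pi fun j : Fin k => μ j.succ)
      (f := f 0) (g := fun y => ∏ i : Fin k, f i.succ (y i)) (hf 0).aemeasurable
      (Finset.measurable_prod _ (fun i _ => (hf i.succ).comp (measurable_pi_apply i))).aemeasurable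
    refine Eq.trans h3 ?_
    rw [ih (fun j => μ j.succ) (fun j => f j.succ) (fun j => hf _)]

lemma aux_ig_nonneg {α B u : ℝ} (hα : 0 < α) (hB : 0 ≤ B) (hu : 0 ≤ u) : 0 ≤ igDens α B u := by
  unfold igDens
  have := Real.Gamma_pos_of_pos hα
  positivity

lemma aux_ig_moment {α B e : ℝ} (hα : 0 < α) (hB : 0 < B) (he : e < α) :
    ∫⁻ u in Set.Ioi (0:ℝ), ENNReal.ofReal (u ^ e) * ENNReal.ofReal (igDens α B u) =
      ENNReal.ofReal (B ^ e * (Real.Gamma (α - e) / Real.Gamma α)) := by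
  set g : ℝ → ℝ := fun w => w ^ ((α - e) - 1) * Real.exp (-(B * w)) with hg
  have hae : 0 < α - e := by linarith
  have hΓ := Real.Gamma_pos_of_pos hα
  have hΓe := Real.Gamma_pos_of_pos hae
  have hgi : IntegrableOn g (Set.Ioi 0) := by
    have := Real.integral_rpow_mul_exp_neg_mul_Ioi hae hB
    by_contra hni
    rw [show (∫ t in Set.Ioi (0:ℝ), t ^ (α - e - 1) * Real.exp (-(B * t))) = 0 from
      integral_undef hni] at this
    have h2 : 0 < (1 / B) ^ (α - e) * Real.Gamma (α - e) := by positivity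
    linarith
  have hcong : ∀ u ∈ Set.Ioi (0:ℝ), u ^ e * igDens α B u =
      (B ^ α * (Real.Gamma α)⁻¹) * ((|(-1:ℝ)| * u ^ ((-1:ℝ) - 1)) • g (u ^ (-1:ℝ))) := by
    intro u hu
    have hu : 0 < u := hu
    simp only [hg, igDens, smul_eq_mul, abs_neg, abs_one, one_mul]
    rw [← Real.rpow_mul hu.le]
    rw [show -(B * u ^ (-1:ℝ)) = -B / u by rw [Real.rpow_neg_one]; ring]
    rw [show u ^ e * (B ^ α * (Real.Gamma α)⁻¹ * u ^ (-α - 1) * Real.exp (-B / u)) =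
      B ^ α * (Real.Gamma α)⁻¹ * ((u ^ e * u ^ (-α - 1)) * Real.exp (-B / u)) by ring,
      ← Real.rpow_add hu, ← mul_assoc (u ^ _) (u ^ _), ← Real.rpow_add hu]
    ring_nf
  have hint : IntegrableOn (fun u => u ^ e * igDens α B u) (Set.Ioi 0) := by
    refine (integrableOn_congr_fun hcong measurableSet_Ioi).2 ?_
    exact ((integrableOn_Ioi_comp_rpow_iff g (by norm_num : (-1:ℝ) ≠ 0)).2 hgi).const_mul _
  have hval : ∫ u in Set.Ioi (0:ℝ), u ^ e * igDens α B u =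
      B ^ e * (Real.Gamma (α - e) / Real.Gamma α) := by
    rw [setIntegral_congr_fun measurableSet_Ioi hcong, integral_const_mul,
      integral_comp_rpow_Ioi g (by norm_num : (-1:ℝ) ≠ 0), hg,
      Real.integral_rpow_mul_exp_neg_mul_Ioi hae hB, one_div, Real.inv_rpow hB.le,
      ← Real.rpow_neg hB.le]
    rw [show B ^ α * (Real.Gamma α)⁻¹ * (B ^ (-(α - e)) * Real.Gamma (α - e)) =
      (B ^ α * B ^ (-(α - e))) * (Real.Gamma (α - e) / Real.Gamma α) by ring, ← Real.rpow_add hB]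
    ring_nf
  rw [← hval, ofReal_integral_eq_lintegral_ofReal hint]
  · refine setLIntegral_congr_fun measurableSet_Ioi ?_
    intro u hu
    have hu : 0 < u := hu
    simp only
    rw [ENNReal.ofReal_mul (by positivity)]
  · refine (ae_restrict_mem measurableSet_Ioi).mono ?_
    intro u hu
    have hu : 0 < u := hu
    exact mul_nonneg (by positivity) (aux_ig_nonneg hα hB.le hu.le)

lemma aux_ig_mass {α B : ℝ} (hα : 0 < α) (hB : 0 < B) :
    ∫⁻ u in Set.Ioi (0:ℝ), ENNReal.ofReal (igDens α B u) = 1 := by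
  have := aux_ig_moment (e := 0) hα hB hα
  have hΓ := Real.Gamma_pos_of_pos hα
  simpa [hΓ.ne'] using this

lemma aux_ig_meas (α B : ℝ) : Measurable (igDens α B) := by
  unfold igDens; fun_prop

lemma aux_pi_ig {p : ℕ} (B : Fin p → ℝ) (hB : ∀ i, 0 < B i) (j : Fin p) (h : ℝ → ENNReal)
    (hh : Measurable h) :
    ∫⁻ x in Set.univ.pi (fun _ : Fin p => Set.Ioi (0:ℝ)),
      h (x j) * ∏ i, ENNReal.ofReal (igDens 1 (B i) (x i)) =
    ∫⁻ u in Set.Ioi (0:ℝ), h u * ENNReal.ofReal (igDens 1 (B j) u) := by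
  classical
  rw [volume_pi, Measure.restrict_pi_pi]
  set f : Fin p → ℝ → ENNReal := fun i u =>
    (if i = j then h u else 1) * ENNReal.ofReal (igDens 1 (B i) u) with hf
  have hfm : ∀ i, Measurable (f i) := by
    intro i
    by_cases hij : i = j
    · simp only [hf, hij, if_true]
      exact hh.mul (aux_ig_meas _ _).ennreal_ofReal
    · simp only [hf, hij, if_false, one_mul]
      exact (aux_ig_meas _ _).ennreal_ofReal
  have h1 : ∀ x : Fin p → ℝ, h (x j) * ∏ i, ENNReal.ofReal (igDens 1 (B i) (x i)) =
      ∏ i, f i (x i) := by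
    intro x
    simp only [hf, Finset.prod_mul_distrib]
    simp
  simp only [h1]
  rw [aux_lprod _ f hfm, Finset.prod_eq_single j]
  · simp [hf]
  · intro i _ hij
    simp only [hf, hij, if_false, one_mul]
    exact aux_ig_mass one_pos (hB i)
  · simp


open ProbabilityTheory in
lemma aux_pi_gauss (p : ℕ) : Measure.pi (fun _ : Fin p => gaussianReal 0 1) =
    (volume : Measure (Fin p → ℝ)).withDensity (fun z => ∏ i, gaussianPDF 0 1 (z i)) := by
  symm
  refine (Measure.pi_eq ?_).symm
  intro s hs
  rw [withDensity_apply _ (MeasurableSet.univ_pi hs), volume_pi, Measure.restrict_pi_pi,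
    aux_lprod _ _ (fun i => measurable_gaussianPDF 0 1)]
  refine Finset.prod_congr rfl fun i _ => ?_
  rw [gaussianReal_apply _ one_ne_zero]

open ProbabilityTheory in
lemma aux_law {p : ℕ} (c : Fin p → ℝ) (m : ℝ) :
    (Measure.pi (fun _ : Fin p => gaussianReal 0 1)).map (fun z => m + ∑ i, c i * z i) =
      gaussianReal m (∑ i, c i ^ 2).toNNReal := by
  have h0 : (Measure.pi (fun _ : Fin p => gaussianReal 0 1)).map (fun z => ∑ i, c i * z i) =
      gaussianReal 0 (∑ i, c i ^ 2).toNNReal := by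
    set L : StrongDual ℝ (EuclideanSpace ℝ (Fin p)) := innerSL ℝ (WithLp.toLp 2 c) with hL
    have h1 : (fun z : Fin p → ℝ => ∑ i, c i * z i) = L ∘ (WithLp.toLp 2) := by
      ext z
      simp [hL, PiLp.inner_apply, mul_comm]
    rw [h1, ← Measure.map_map (by fun_prop) (by fun_prop), map_pi_eq_stdGaussian,
      IsGaussian.map_eq_gaussianReal, integral_strongDual_stdGaussian, variance_dual_stdGaussian]
    congr 2
    rw [hL, innerSL_apply_norm, EuclideanSpace.real_norm_sq_eq]
  have h2 : (fun z : Fin p → ℝ => m + ∑ i, c i * z i) = (fun u => m + u) ∘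
    (fun z : Fin p → ℝ => ∑ i, c i * z i) := rfl
  rw [h2, ← Measure.map_map (by fun_prop) (by fun_prop), h0, gaussianReal_map_const_add, zero_add]

open ProbabilityTheory in
lemma aux_gauss_marg {p : ℕ} (A : Matrix (Fin p) (Fin p) ℝ) (hA : A.PosDef) (μ : Fin p → ℝ)
    {s : ℝ} (hs : 0 < s) (j : Fin p) (h : ℝ → ENNReal) (hh : Measurable h) :
    ∫⁻ β : Fin p → ℝ, ENNReal.ofReal (gaussDens p A μ s β) * h (β j) =
      ∫⁻ w, h w ∂(gaussianReal (μ j) (s * A⁻¹ j j).toNNReal) := by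
  obtain ⟨R, hR, hAR⟩ := by
    open scoped MatrixOrder Matrix.Norms.L2Operator in
    exact CStarAlgebra.isStrictlyPositive_iff_eq_star_mul_self.mp hA.isStrictlyPositive
  have hRd : R.det ≠ 0 := ((Matrix.isUnit_iff_isUnit_det R).1 hR).ne_zero
  have hAR' : A = Rᵀ * R := by simpa [Matrix.star_eq_conjTranspose] using hAR
  set q : ℝ := √s with hq
  have hq0 : 0 < q := Real.sqrt_pos.2 hs
  have hqq : q ^ 2 = s := Real.sq_sqrt hs.le
  set M : Matrix (Fin p) (Fin p) ℝ := q⁻¹ • R with hM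
  have hMd : M.det = (q⁻¹) ^ p * R.det := by simp [hM]
  have hMd0 : M.det ≠ 0 := by rw [hMd]; positivity
  have hMu : IsUnit M.det := isUnit_iff_ne_zero.2 hMd0
  set N := M⁻¹ with hN
  have hNM : N * M = 1 := Matrix.nonsing_inv_mul M hMu
  set G : (Fin p → ℝ) → ENNReal := fun z =>
    ENNReal.ofReal (|M.det|) * ((∏ i, gaussianPDF 0 1 (z i)) * h (μ j + ∑ i, N j i * z i)) with hG
  have hGm : Measurable fun z : Fin p → ℝ =>
      (∏ i, gaussianPDF 0 1 (z i)) * h (μ j + ∑ i, N j i * z i) := by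
    refine Measurable.mul ?_ (hh.comp (by fun_prop))
    exact Finset.measurable_prod _ fun i _ => (measurable_gaussianPDF 0 1).comp (measurable_pi_apply i)
  have hkey : ∀ β : Fin p → ℝ, ENNReal.ofReal (gaussDens p A μ s β) * h (β j) =
      G (Matrix.toLin' M (β - μ)) := by
    intro β
    have e1 : μ j + ∑ i, N j i * (Matrix.toLin' M (β - μ)) i = β j := by
      have : N *ᵥ (M *ᵥ (β - μ)) = β - μ := by
        rw [Matrix.mulVec_mulVec, hNM, Matrix.one_mulVec]
      have := congrFun this j
      simp only [Matrix.toLin'_apply]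
      simp only [Matrix.mulVec, dotProduct, Pi.sub_apply] at this ⊢
      linarith
    have e2 : gaussDens p A μ s β =
        |M.det| * ∏ i, gaussianPDFReal 0 1 ((Matrix.toLin' M (β - μ)) i) := by
      set v := β - μ with hv
      have e3 : v ⬝ᵥ A.mulVec v = s * ∑ i, (Matrix.toLin' M v i) ^ 2 := by
        have : M *ᵥ v = q⁻¹ • (R *ᵥ v) := by rw [hM, Matrix.smul_mulVec]
        have h4 : v ⬝ᵥ A.mulVec v = (R *ᵥ v) ⬝ᵥ (R *ᵥ v) := by
          rw [hAR', ← Matrix.mulVec_mulVec, Matrix.dotProduct_mulVec, Matrix.vecMul_transpose]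
        rw [h4]
        simp only [Matrix.toLin'_apply, this, Pi.smul_apply, smul_eq_mul, mul_pow, dotProduct]
        rw [← Finset.mul_sum, inv_pow, hqq, ← mul_assoc, mul_inv_cancel₀ hs.ne', one_mul]
        exact Finset.sum_congr rfl fun i _ => by ring
      unfold gaussDens
      rw [← hv, e3]
      simp only [gaussianPDFReal, Finset.prod_mul_distrib, ← Real.exp_sum, Finset.prod_const,
        Finset.card_univ, Fintype.card_fin, NNReal.coe_one, mul_one, sub_zero]
      rw [show -(s * ∑ i, (Matrix.toLin' M v i) ^ 2) / (2 * s) =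
        ∑ i, -(Matrix.toLin' M v i) ^ 2 / 2 by
          rw [← Finset.sum_div, Finset.sum_neg_distrib]; field_simp]
      rw [← mul_assoc]
      congr 1
      have e5 : A.det ^ ((1:ℝ)/2) = |R.det| := by
        rw [hAR', Matrix.det_mul, Matrix.det_transpose, ← Real.sqrt_eq_rpow, Real.sqrt_mul_self_eq_abs]
      rw [e5, hMd, abs_mul, abs_of_pos (by positivity : 0 < q⁻¹ ^ p)]
      have e6 : (2 * Real.pi * s) ^ (-(p:ℝ)/2) = (√(2 * Real.pi))⁻¹ ^ p * q⁻¹ ^ p := by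
        rw [← mul_pow, ← mul_inv, hq, ← Real.sqrt_mul (by positivity), Real.sqrt_eq_rpow,
          ← Real.rpow_neg (by positivity), ← Real.rpow_natCast, ← Real.rpow_mul (by positivity)]
        congr 1; ring
      rw [e6]; ring
    rw [hG]
    simp only
    rw [e1, e2, ENNReal.ofReal_mul (abs_nonneg _), ENNReal.ofReal_prod_of_nonneg
      (fun i _ => gaussianPDFReal_nonneg _ _ _), mul_assoc]
    rfl
  simp only [hkey]
  rw [lintegral_sub_right_eq_self (fun β => G (Matrix.toLin' M β)) μ,
    ← lintegral_map (f := G) (g := Matrix.toLin' M) (hGm.const_mul _)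
      (LinearMap.continuous_of_finiteDimensional _).measurable,
    Real.map_matrix_volume_pi_eq_smul_volume_pi hMd0, lintegral_smul_measure, hG,
    lintegral_const_mul _ hGm, smul_eq_mul, ← mul_assoc, ← ENNReal.ofReal_mul (abs_nonneg _),
    ← abs_mul, inv_mul_cancel₀ hMd0]
  simp only [abs_one, ENNReal.ofReal_one, one_mul]
  have hpm : Measurable fun z : Fin p → ℝ => ∏ i, gaussianPDF 0 1 (z i) :=
    Finset.measurable_prod _ fun i _ => (measurable_gaussianPDF 0 1).comp (measurable_pi_apply i)
  have := lintegral_withDensity_eq_lintegral_mul (volume : Measure (Fin p → ℝ)) hpm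
    (g := fun z => h (μ j + ∑ i, N j i * z i)) (hh.comp (by fun_prop))
  simp only [Pi.mul_apply] at this
  rw [← this, ← aux_pi_gauss, ← lintegral_map (f := h) hh (by fun_prop), aux_law]
  congr 3
  have hNN : A⁻¹ = s⁻¹ • (N * Nᵀ) := by
    have : A = s • (Mᵀ * M) := by
      rw [hAR', hM, Matrix.transpose_smul, Matrix.smul_mul, Matrix.mul_smul, smul_smul, smul_smul,
        ← hqq]
      rw [show q ^ 2 * q⁻¹ * q⁻¹ = 1 by field_simp, one_smul]
    apply Matrix.inv_eq_right_inv
    rw [this, Matrix.smul_mul, Matrix.mul_smul, smul_smul, mul_inv_cancel₀ hs.ne', one_smul]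
    rw [show Mᵀ * M * (N * Nᵀ) = Mᵀ * (M * N) * Nᵀ by simp only [Matrix.mul_assoc],
      hN, Matrix.mul_nonsing_inv M hMu, Matrix.mul_one, ← Matrix.transpose_mul,
      Matrix.nonsing_inv_mul M hMu, Matrix.transpose_one]
  rw [hNN, Matrix.smul_apply, smul_eq_mul, ← mul_assoc, mul_inv_cancel₀ hs.ne', one_mul,
    Matrix.mul_apply]
  exact Finset.sum_congr rfl fun i _ => by rw [Matrix.transpose_apply]; ring


open ProbabilityTheory in
lemma aux_gauss_pos (m : ℝ) (V : NNReal) (hV : 0 < (V:ℝ)) {c : ℝ} (hc0 : 0 < c) (hc1 : c < 1) :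
    ∫⁻ w, ENNReal.ofReal ((w ^ 2) ^ c) ∂(gaussianReal m V) ≤ ENNReal.ofReal ((m ^ 2 + V) ^ c) := by
  set K : ℝ := m ^ 2 + V with hK
  have hK0 : 0 < K := by positivity
  have hint : Integrable (fun w : ℝ => w ^ 2) (gaussianReal m V) :=
    (memLp_id_gaussianReal 2).integrable_sq
  have hE : ∫ w, w ^ 2 ∂(gaussianReal m V) = K := by
    have h1 := variance_eq_sub (X := id) (μ := gaussianReal m V) (memLp_id_gaussianReal 2)
    rw [variance_id_gaussianReal] at h1
    simp only [id, Pi.pow_apply] at h1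
    rw [integral_id_gaussianReal] at h1
    rw [hK]
    linarith
  have hpt : ∀ w : ℝ, (w ^ 2) ^ c ≤ K ^ c * (c * (w ^ 2 / K) + (1 - c)) := by
    intro w
    have h1 := Real.geom_mean_le_arith_mean2_weighted hc0.le (by linarith : 0 ≤ 1 - c)
      (by positivity : 0 ≤ w ^ 2 / K) zero_le_one (by ring)
    rw [Real.one_rpow, mul_one, mul_one, Real.div_rpow (by positivity) hK0.le] at h1
    have hKc : 0 < K ^ c := by positivity
    calc (w ^ 2) ^ c = K ^ c * ((w ^ 2) ^ c / K ^ c) := by field_simp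
      _ ≤ _ := mul_le_mul_of_nonneg_left h1 hKc.le
  have hint2 : Integrable (fun w : ℝ => K ^ c * (c * (w ^ 2 / K) + (1 - c))) (gaussianReal m V) :=
    (((hint.div_const K).const_mul c).add (integrable_const _)).const_mul _
  calc ∫⁻ w, ENNReal.ofReal ((w ^ 2) ^ c) ∂(gaussianReal m V)
      ≤ ∫⁻ w, ENNReal.ofReal (K ^ c * (c * (w ^ 2 / K) + (1 - c))) ∂(gaussianReal m V) :=
        lintegral_mono fun w => ENNReal.ofReal_le_ofReal (hpt w)
    _ = ENNReal.ofReal (∫ w, K ^ c * (c * (w ^ 2 / K) + (1 - c)) ∂(gaussianReal m V)) := by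
        rw [ofReal_integral_eq_lintegral_ofReal hint2]
        exact Filter.Eventually.of_forall fun w => le_trans (by positivity) (hpt w)
    _ = _ := by
        rw [integral_const_mul, integral_add ((hint.div_const K).const_mul c) (integrable_const _),
          integral_const_mul, integral_div, hE, div_self hK0.ne']
        simp

open ProbabilityTheory in
lemma aux_gauss_neg1 (m : ℝ) {q : ℝ} (hq0 : 0 < q) (hq1 : 2 * q < 1) :
    ∫⁻ w, ENNReal.ofReal (|w| ^ (-(2 * q))) ∂(gaussianReal m 1) ≤
      ENNReal.ofReal (1 / (1 - 2 * q)) := by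
  set F : ℝ → ENNReal := (Set.Ioc (0:ℝ) 1).indicator fun w => ENNReal.ofReal (w ^ (-(2 * q)) - 1)
    with hF
  have hFm : Measurable F := Measurable.indicator (by fun_prop) measurableSet_Ioc
  have hFI : ∫⁻ w, F w = ENNReal.ofReal (1 / (1 - 2 * q) - 1) := by
    rw [hF, lintegral_indicator measurableSet_Ioc]
    have hi : IntervalIntegrable (fun w : ℝ => w ^ (-(2 * q)) - 1) volume 0 1 :=
      (intervalIntegral.intervalIntegrable_rpow' (by linarith)).sub intervalIntegrable_const
    rw [← ofReal_integral_eq_lintegral_ofReal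
      ((intervalIntegrable_iff_integrableOn_Ioc_of_le zero_le_one).1 hi)]
    · rw [← intervalIntegral.integral_of_le zero_le_one, intervalIntegral.integral_sub
        (intervalIntegral.intervalIntegrable_rpow' (by linarith)) intervalIntegrable_const,
        integral_rpow (Or.inl (by linarith))]
      rw [Real.one_rpow, Real.zero_rpow (by linarith)]
      simp
      ring_nf
    · refine (ae_restrict_mem measurableSet_Ioc).mono ?_
      intro w hw
      have := Real.one_le_rpow_of_pos_of_le_one_of_nonpos hw.1 hw.2 (by linarith : -(2 * q) ≤ 0)
      simp only [Pi.zero_apply]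
      linarith
  have hpt : ∀ w : ℝ, ENNReal.ofReal (|w| ^ (-(2 * q))) ≤ 1 + (F w + F (-w)) := by
    have hpos : ∀ w : ℝ, 0 < w → ENNReal.ofReal (w ^ (-(2 * q))) ≤ 1 + F w := by
      intro w hw
      by_cases h1 : w ≤ 1
      · have := Real.one_le_rpow_of_pos_of_le_one_of_nonpos hw h1 (by linarith : -(2 * q) ≤ 0)
        rw [hF, Set.indicator_of_mem (Set.mem_Ioc.2 ⟨hw, h1⟩), ← ENNReal.ofReal_one, ← ENNReal.ofReal_add
          zero_le_one (by linarith)]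
        exact ENNReal.ofReal_le_ofReal (by linarith)
      · push Not at h1
        have := Real.rpow_le_one_of_one_le_of_nonpos h1.le (by linarith : -(2 * q) ≤ 0)
        refine le_trans ?_ le_self_add
        rw [← ENNReal.ofReal_one]
        exact ENNReal.ofReal_le_ofReal this
    intro w
    rcases lt_trichotomy w 0 with h | h | h
    · rw [abs_of_neg h]
      refine (hpos (-w) (by linarith)).trans ?_
      gcongr
      exact le_add_self
    · subst h
      rw [abs_zero, Real.zero_rpow (by linarith)]
      simp
    · rw [abs_of_pos h]
      refine (hpos w h).trans ?_
      gcongr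
      exact le_self_add
  have hFFm : Measurable fun w : ℝ => F w + F (-w) := hFm.add (hFm.comp measurable_neg)
  have hpdf : ∀ w, gaussianPDF m 1 w ≤ ENNReal.ofReal (1 / 2) := by
    intro w
    refine ENNReal.ofReal_le_ofReal ?_
    unfold gaussianPDFReal
    have h1 : (2:ℝ) ≤ √(2 * Real.pi * (1:NNReal)) := by
      apply Real.le_sqrt_of_sq_le
      have := Real.pi_gt_three
      simp only [NNReal.coe_one]
      linarith
    have h2 : Real.exp (-(w - m) ^ 2 / (2 * (1:NNReal))) ≤ 1 := by
      apply Real.exp_le_one_iff.2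
      rw [NNReal.coe_one]
      have := sq_nonneg (w - m)
      linarith
    calc (√(2 * Real.pi * (1:NNReal)))⁻¹ * Real.exp (-(w - m) ^ 2 / (2 * (1:NNReal)))
        ≤ (2:ℝ)⁻¹ * 1 := by gcongr
      _ = 1 / 2 := by norm_num
  have hq' : 0 < 1 - 2 * q := by linarith
  have hnn : 0 ≤ 1 / (1 - 2 * q) - 1 := by
    rw [sub_nonneg, le_div_iff₀ hq']; linarith
  calc ∫⁻ w, ENNReal.ofReal (|w| ^ (-(2 * q))) ∂(gaussianReal m 1)
      ≤ ∫⁻ w, (1 + (F w + F (-w))) ∂(gaussianReal m 1) := lintegral_mono hpt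
    _ = 1 + ∫⁻ w, (F w + F (-w)) ∂(gaussianReal m 1) := by
        rw [lintegral_add_left measurable_const]; simp
    _ ≤ 1 + ∫⁻ w, ENNReal.ofReal (1/2) * (F w + F (-w)) := by
        refine add_le_add_right ?_ 1
        rw [gaussianReal_of_var_ne_zero _ one_ne_zero, lintegral_withDensity_eq_lintegral_mul _
          (measurable_gaussianPDF m 1) hFFm]
        refine lintegral_mono fun w => ?_
        simp only [Pi.mul_apply]
        gcongr
        exact hpdf w
    _ = 1 + ENNReal.ofReal (1/2) * (ENNReal.ofReal (1 / (1 - 2 * q) - 1) +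
          ENNReal.ofReal (1 / (1 - 2 * q) - 1)) := by
        rw [lintegral_const_mul _ hFFm, lintegral_add_left hFm,
          lintegral_neg_eq_self, hFI]
    _ = ENNReal.ofReal (1 / (1 - 2 * q)) := by
        rw [← ENNReal.ofReal_add hnn hnn, ← ENNReal.ofReal_mul (by norm_num), ← ENNReal.ofReal_one,
          ← ENNReal.ofReal_add zero_le_one (by positivity)]
        congr 1; ring

open ProbabilityTheory in
lemma aux_gauss_neg (m V : ℝ) (hV : 0 < V) {q : ℝ} (hq0 : 0 < q) (hq1 : 2 * q < 1) :
    ∫⁻ w, ENNReal.ofReal ((w ^ 2) ^ (-q)) ∂(gaussianReal m V.toNNReal) ≤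
      ENNReal.ofReal (V ^ (-q) * (1 / (1 - 2 * q))) := by
  have hL : 0 < √V := Real.sqrt_pos.2 hV
  have h1 : gaussianReal m V.toNNReal = (gaussianReal (m / √V) 1).map (√V * ·) := by
    rw [gaussianReal_map_const_mul]
    congr 1
    · field_simp
    · ext; simp [Real.sq_sqrt hV.le, hV.le]
  have h2 : ∀ w : ℝ, ENNReal.ofReal (((√V * w) ^ 2) ^ (-q)) =
      ENNReal.ofReal (V ^ (-q)) * ENNReal.ofReal (|w| ^ (-(2 * q))) := by
    intro w
    rw [← ENNReal.ofReal_mul (by positivity)]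
    congr 1
    rw [mul_pow, Real.sq_sqrt hV.le, Real.mul_rpow hV.le (by positivity), ← sq_abs w,
      ← Real.rpow_natCast, ← Real.rpow_mul (abs_nonneg w)]
    push_cast
    ring_nf
  rw [h1, lintegral_map (by fun_prop) (by fun_prop)]
  simp only [h2]
  rw [lintegral_const_mul _ (by fun_prop), ENNReal.ofReal_mul (by positivity)]
  gcongr
  exact aux_gauss_neg1 _ hq0 hq1

/-- The weighted AM-GM constant. -/
noncomputable def auxκ (d : ℝ) : ℝ := (7/8 : ℝ) ^ (7/8 * d) * (1/8 : ℝ) ^ (d/8)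

open ProbabilityTheory in
lemma aux_gauss_neg2 (m V u k : ℝ) (hV : 0 < V) (hu : 0 < u) (hk : 0 < k) {d : ℝ} (hd0 : 0 < d)
    (hd1 : d < 1) :
    ∫⁻ w, ENNReal.ofReal ((u + w ^ 2 * k) ^ (-d)) ∂(gaussianReal m V.toNNReal) ≤
      ENNReal.ofReal (auxκ d * u ^ (-(7/8 * d)) * (k ^ (-(d/8)) *
        (V ^ (-(d/8)) * (1 / (1 - d / 4))))) := by
  have hpt : ∀ w : ℝ, w ≠ 0 → (u + w ^ 2 * k) ^ (-d) ≤
      auxκ d * u ^ (-(7/8 * d)) * (k ^ (-(d/8)) * (w ^ 2) ^ (-(d/8))) := by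
    intro w hw
    have hw2 : 0 < w ^ 2 := by positivity
    have h1 := Real.geom_mean_le_arith_mean2_weighted (by norm_num : (0:ℝ) ≤ 7/8)
      (by norm_num : (0:ℝ) ≤ 1/8) (by positivity : 0 ≤ u / (7/8)) (by positivity :
        0 ≤ w ^ 2 * k / (1/8)) (by norm_num)
    rw [show (7/8:ℝ) * (u / (7/8)) + 1/8 * (w ^ 2 * k / (1/8)) = u + w ^ 2 * k by ring] at h1
    have h2 := Real.rpow_le_rpow_of_nonpos (by positivity) h1 (by linarith : -d ≤ 0)
    refine h2.trans (le_of_eq ?_)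
    rw [Real.mul_rpow (by positivity) (by positivity), ← Real.rpow_mul (by positivity),
      ← Real.rpow_mul (by positivity), Real.div_rpow hu.le (by norm_num : (0:ℝ) ≤ 7/8),
      Real.div_rpow (by positivity : 0 ≤ w ^ 2 * k) (by norm_num : (0:ℝ) ≤ 1/8), Real.mul_rpow hw2.le hk.le, auxκ,
      show (7/8:ℝ) * -d = -(7/8 * d) by ring, show (1/8:ℝ) * -d = -(d/8) by ring,
      Real.rpow_neg (by norm_num : (0:ℝ) ≤ 7/8), Real.rpow_neg (by norm_num : (0:ℝ) ≤ 1/8)]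
    simp only [div_inv_eq_mul]
    ring
  have hκ : 0 ≤ auxκ d := by unfold auxκ; positivity
  have hV' : V.toNNReal ≠ 0 := by simpa using hV
  have hae : ∀ᵐ w ∂(gaussianReal m V.toNNReal), w ≠ 0 := by
    have := nullSingletonClass_gaussianReal (μ := m) hV'
    rw [ae_iff]
    simp
  calc _ ≤ ∫⁻ w, ENNReal.ofReal (auxκ d * u ^ (-(7/8 * d)) * k ^ (-(d/8))) *
        ENNReal.ofReal ((w ^ 2) ^ (-(d/8))) ∂(gaussianReal m V.toNNReal) := by
        refine lintegral_mono_ae (hae.mono fun w hw => ?_)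
        rw [← ENNReal.ofReal_mul (by positivity)]
        refine ENNReal.ofReal_le_ofReal ((hpt w hw).trans (le_of_eq (by ring)))
    _ ≤ ENNReal.ofReal (auxκ d * u ^ (-(7/8 * d)) * k ^ (-(d/8))) *
        ENNReal.ofReal (V ^ (-(d/8)) * (1 / (1 - 2 * (d/8)))) := by
        rw [lintegral_const_mul _ (by fun_prop)]
        gcongr
        exact aux_gauss_neg m V hV (by positivity) (by linarith)
    _ = _ := by
        rw [← ENNReal.ofReal_mul (by positivity)]
        congr 1
        rw [show 1 - 2 * (d/8) = 1 - d/4 by ring]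
        ring


/-- `XᵀX + diag D`. -/
noncomputable def auxA {n p : ℕ} (X : Matrix (Fin n) (Fin p) ℝ) (D : Fin p → ℝ) :
    Matrix (Fin p) (Fin p) ℝ := X.transpose * X + Matrix.diagonal D

lemma aux_hsA {n p : ℕ} (X : Matrix (Fin n) (Fin p) ℝ) {t : ℝ} (ht : 0 < t) {x : Fin p → ℝ}
    (hx : ∀ j, 0 < x j) : hsA n p X t x = auxA X (fun j => (t * x j)⁻¹) := by
  unfold hsA auxA
  congr 1
  apply Matrix.inv_eq_right_inv
  rw [← Matrix.diagonal_smul, Matrix.diagonal_mul_diagonal, ← Matrix.diagonal_one]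
  congr 1
  ext j
  have := hx j
  simp only [Pi.smul_apply, smul_eq_mul]
  field_simp

lemma auxA_bilin {n p : ℕ} (X : Matrix (Fin n) (Fin p) ℝ) (D : Fin p → ℝ) (h v : Fin p → ℝ) :
    h ⬝ᵥ (auxA X D *ᵥ v) = (X *ᵥ h) ⬝ᵥ (X *ᵥ v) + ∑ j, D j * v j * h j := by
  unfold auxA
  rw [Matrix.add_mulVec, dotProduct_add, ← Matrix.mulVec_mulVec, Matrix.dotProduct_mulVec,
    Matrix.vecMul_transpose]
  congr 1
  simp only [dotProduct, Matrix.mulVec_diagonal]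
  exact Finset.sum_congr rfl fun j _ => by ring

lemma auxA_symm {n p : ℕ} (X : Matrix (Fin n) (Fin p) ℝ) (D : Fin p → ℝ) :
    (auxA X D)ᵀ = auxA X D := by
  unfold auxA; simp [Matrix.transpose_add, Matrix.transpose_mul]

lemma auxA_posDef {n p : ℕ} (X : Matrix (Fin n) (Fin p) ℝ) {D : Fin p → ℝ} (hD : ∀ j, 0 < D j) :
    (auxA X D).PosDef := by
  refine Matrix.posDef_iff_dotProduct_mulVec.2 ⟨?_, ?_⟩
  · rw [Matrix.IsHermitian, Matrix.conjTranspose_eq_transpose_of_trivial, auxA_symm]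
  · intro v hv
    rw [star_trivial, auxA_bilin]
    have h1 : 0 ≤ (X *ᵥ v) ⬝ᵥ (X *ᵥ v) :=
      Finset.sum_nonneg fun i _ => mul_self_nonneg _
    obtain ⟨j, hj⟩ := Function.ne_iff.1 hv
    have h2 : 0 < ∑ j, D j * v j * v j := by
      refine Finset.sum_pos' (fun i _ => ?_) ⟨j, Finset.mem_univ j, ?_⟩
      · rw [mul_assoc]; exact mul_nonneg (hD i).le (mul_self_nonneg _)
      · rw [mul_assoc]; exact mul_pos (hD j) (mul_self_pos.2 hj)
    linarith

lemma auxA_det {n p : ℕ} (X : Matrix (Fin n) (Fin p) ℝ) {D : Fin p → ℝ} (hD : ∀ j, 0 < D j) :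
    IsUnit (auxA X D).det := isUnit_iff_ne_zero.2 (auxA_posDef X hD).det_pos.ne'

lemma auxA_mulinv {n p : ℕ} (X : Matrix (Fin n) (Fin p) ℝ) {D : Fin p → ℝ} (hD : ∀ j, 0 < D j)
    (v : Fin p → ℝ) : auxA X D *ᵥ ((auxA X D)⁻¹ *ᵥ v) = v := by
  rw [Matrix.mulVec_mulVec, Matrix.mul_nonsing_inv _ (auxA_det X hD), Matrix.one_mulVec]

lemma auxA_inv_diag {n p : ℕ} (X : Matrix (Fin n) (Fin p) ℝ) {D : Fin p → ℝ} (hD : ∀ j, 0 < D j)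
    (j : Fin p) : 0 < (auxA X D)⁻¹ j j ∧ (auxA X D)⁻¹ j j ≤ (D j)⁻¹ ∧
      1 ≤ (auxA X D)⁻¹ j j * (auxA X D) j j := by
  have hpos : 0 < (auxA X D)⁻¹ j j := (auxA_posDef X hD).inv.diag_pos
  set w : Fin p → ℝ := (auxA X D)⁻¹ *ᵥ Pi.single j 1 with hw
  have hwj : w j = (auxA X D)⁻¹ j j := by simp [hw]
  have hAw : auxA X D *ᵥ w = Pi.single j 1 := auxA_mulinv X hD _
  rw [← hwj] at hpos ⊢
  refine ⟨hpos, ?_, ?_⟩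
  · have h1 := auxA_bilin X D w w
    rw [hAw, dotProduct_single, mul_one] at h1
    have h2 : 0 ≤ (X *ᵥ w) ⬝ᵥ (X *ᵥ w) :=
      Finset.sum_nonneg fun i _ => mul_self_nonneg _
    have h3 : D j * w j * w j ≤ ∑ j, D j * w j * w j :=
      Finset.single_le_sum (f := fun j => D j * w j * w j)
        (fun i _ => by rw [mul_assoc]; exact mul_nonneg (hD i).le (mul_self_nonneg _))
        (Finset.mem_univ j)
    have h4 : D j * w j * w j ≤ 1 * w j := by linarith
    have h5 := le_of_mul_le_mul_right h4 hpos
    rw [le_inv_comm₀ hpos (hD j)]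
    rw [inv_eq_one_div, le_div_iff₀ hpos]
    exact h5
  · set a := auxA X D j j with ha
    have hcol : (auxA X D *ᵥ Pi.single j 1) j = a := by simp [ha]
    have hapos : 0 < a := (auxA_posDef X hD).diag_pos
    set v : Fin p → ℝ := Pi.single j 1 - a • w with hv
    have h0 : 0 ≤ v ⬝ᵥ (auxA X D *ᵥ v) := by
      have := (auxA_posDef X hD).posSemidef.dotProduct_mulVec_nonneg v
      simpa using this
    have hAv : auxA X D *ᵥ v = auxA X D *ᵥ Pi.single j 1 - a • Pi.single j 1 := by
      rw [hv, Matrix.mulVec_sub, Matrix.mulVec_smul, hAw]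
    have hwA : w ⬝ᵥ (auxA X D *ᵥ Pi.single j 1) = 1 := by
      rw [Matrix.dotProduct_mulVec, ← Matrix.mulVec_transpose, auxA_symm, hAw]
      simp
    rw [hAv, hv, sub_dotProduct, dotProduct_sub, dotProduct_sub, smul_dotProduct, smul_dotProduct,
      hwA, single_dotProduct, hcol, dotProduct_smul, dotProduct_smul, dotProduct_single,
      dotProduct_single] at h0
    simp only [Pi.single_eq_same, smul_eq_mul, mul_one, one_mul] at h0
    have h6 : 0 ≤ a * (w j * a - 1) := by linarith
    have := nonneg_of_mul_nonneg_right h6 hapos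
    linarith

lemma aux_normal_eq {n p : ℕ} (X : Matrix (Fin n) (Fin p) ℝ) (y : Fin n → ℝ) (D μ : Fin p → ℝ)
    (hμ : auxA X D *ᵥ μ = Xᵀ *ᵥ y) (h : Fin p → ℝ) :
    (X *ᵥ h) ⬝ᵥ (X *ᵥ μ) + ∑ j, D j * μ j * h j = (X *ᵥ h) ⬝ᵥ y := by
  rw [← auxA_bilin, hμ, Matrix.dotProduct_mulVec, Matrix.vecMul_transpose]

lemma aux_fit_bdd {n p : ℕ} (X : Matrix (Fin n) (Fin p) ℝ) (y : Fin n → ℝ) (D μ : Fin p → ℝ)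
    (hD : ∀ j, 0 < D j) (hμ : auxA X D *ᵥ μ = Xᵀ *ᵥ y) :
    (X *ᵥ μ) ⬝ᵥ (X *ᵥ μ) ≤ y ⬝ᵥ y ∧ 0 ≤ (X *ᵥ μ) ⬝ᵥ y ∧ (X *ᵥ μ) ⬝ᵥ y ≤ y ⬝ᵥ y := by
  have h1 := aux_normal_eq X y D μ hμ μ
  have h2 : 0 ≤ ∑ j, D j * μ j * μ j :=
    Finset.sum_nonneg fun i _ => by rw [mul_assoc]; exact mul_nonneg (hD i).le (mul_self_nonneg _)
  have h3 : 0 ≤ (X *ᵥ μ) ⬝ᵥ (X *ᵥ μ) := Finset.sum_nonneg fun i _ => mul_self_nonneg _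
  have h4 : 0 ≤ (y - X *ᵥ μ) ⬝ᵥ (y - X *ᵥ μ) := Finset.sum_nonneg fun i _ => mul_self_nonneg _
  rw [sub_dotProduct, dotProduct_sub, dotProduct_sub, dotProduct_comm y (X *ᵥ μ)] at h4
  refine ⟨by linarith, by linarith, by linarith⟩

lemma aux_mu_bdd {n p : ℕ} (X : Matrix (Fin n) (Fin p) ℝ) (y : Fin n → ℝ) :
    ∃ C : ℝ, 0 ≤ C ∧ ∀ D : Fin p → ℝ, (∀ j, 0 < D j) → ∀ μ : Fin p → ℝ,
      auxA X D *ᵥ μ = Xᵀ *ᵥ y → ∀ j, μ j ^ 2 ≤ C := by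
  have hσ : ∀ σ : Fin p → SignType, ∃ C : ℝ, 0 ≤ C ∧ ∀ μ : Fin p → ℝ,
      (∀ j, SignType.sign (μ j) = σ j) →
      (∀ h : Fin p → ℝ, X *ᵥ h = 0 → (∀ j, 0 ≤ μ j * h j) → (∀ j, μ j = 0 → h j = 0) → h = 0) →
      ‖μ‖ ≤ C * ‖X *ᵥ μ‖ := by
    intro σ
    set K : Set (Fin p → ℝ) := {h | ∀ j, 0 ≤ (σ j : ℝ) * h j ∧ (σ j = 0 → h j = 0)} with hK
    have hKc : IsClosed K := by
      have hKe : K = ⋂ j, ({h : Fin p → ℝ | 0 ≤ (σ j : ℝ) * h j} ∩ {h | σ j = 0 → h j = 0}) := by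
        ext h
        simp only [hK, Set.mem_iInter, Set.mem_inter_iff, Set.mem_setOf_eq]
      rw [hKe]
      refine isClosed_iInter fun j => ?_
      refine (isClosed_le continuous_const (continuous_const.mul (continuous_apply j))).inter ?_
      by_cases h : σ j = 0
      · simp only [h, true_imp_iff]
        exact isClosed_eq (continuous_apply j) continuous_const
      · simp [h]
    by_cases hker : ∀ h ∈ K, X *ᵥ h = 0 → h = 0
    · have hcomp : IsCompact (K ∩ Metric.sphere 0 1) := (isCompact_sphere 0 1).inter_left hKc
      have hcont : Continuous fun h : Fin p → ℝ => ‖X *ᵥ h‖ := by fun_prop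
      obtain ⟨c, hc0, hc⟩ := hcomp.exists_forall_le' hcont.continuousOn (a := 0) (by
        rintro h ⟨hhK, hh1⟩
        refine norm_pos_iff.2 fun h0 => ?_
        have := hker h hhK h0
        rw [this] at hh1
        simp at hh1)
      refine ⟨c⁻¹, by positivity, ?_⟩
      intro μ hμσ _
      by_cases hμ0 : μ = 0
      · subst hμ0; simp
      have hn : 0 < ‖μ‖ := norm_pos_iff.2 hμ0
      have hmem : ‖μ‖⁻¹ • μ ∈ K ∩ Metric.sphere 0 1 := by
        refine ⟨fun j => ⟨?_, ?_⟩, ?_⟩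
        · simp only [Pi.smul_apply, smul_eq_mul, ← hμσ j]
          rw [mul_left_comm, sign_mul_self]
          positivity
        · intro h0
          rw [← hμσ j, sign_eq_zero_iff] at h0
          simp [h0]
        · simp [norm_smul, hn.ne']
      have := hc _ hmem
      simp only [Matrix.mulVec_smul, norm_smul, norm_inv, norm_norm] at this
      rw [inv_mul_eq_div, le_div_iff₀ hn] at this
      rw [inv_mul_eq_div, le_div_iff₀ hc0]
      linarith
    · push Not at hker
      obtain ⟨h, hhK, hX, hne⟩ := hker
      refine ⟨0, le_rfl, ?_⟩
      intro μ hμσ hP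
      refine absurd (hP h hX (fun j => ?_) (fun j hj => ?_)) hne
      · have h1 := (hhK j).1
        rw [← hμσ j] at h1
        have h2 : μ j = |μ j| * (SignType.sign (μ j) : ℝ) := by rw [mul_comm]; exact (sign_mul_abs _).symm
        rw [h2, mul_assoc]
        exact mul_nonneg (abs_nonneg _) h1
      · exact (hhK j).2 (by rw [← hμσ j, hj, sign_zero])
  choose C hC0 hC using hσ
  refine ⟨∑ σ, C σ ^ 2 * (y ⬝ᵥ y), ?_, ?_⟩
  · refine Finset.sum_nonneg fun σ _ => mul_nonneg (sq_nonneg _) ?_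
    exact Finset.sum_nonneg fun i _ => mul_self_nonneg _
  intro D hD μ hμ j
  have hyy : 0 ≤ y ⬝ᵥ y := Finset.sum_nonneg fun i _ => mul_self_nonneg _
  set σ : Fin p → SignType := fun j => SignType.sign (μ j)
  have h1 := hC σ μ (fun _ => rfl) (by
    intro h hX hs hz
    have h2 := aux_normal_eq X y D μ hμ h
    rw [hX] at h2
    simp only [zero_dotProduct, zero_add] at h2
    have h3 := (Finset.sum_eq_zero_iff_of_nonneg (fun i _ => by
      rw [mul_assoc]; exact mul_nonneg (hD i).le (hs i))).1 h2
    ext i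
    have h4 := h3 i (Finset.mem_univ i)
    rw [mul_assoc] at h4
    have h5 := (mul_eq_zero.1 h4).resolve_left (hD i).ne'
    rcases mul_eq_zero.1 h5 with h6 | h6
    · exact hz i h6
    · exact h6)
  have h2 : ‖X *ᵥ μ‖ ^ 2 ≤ y ⬝ᵥ y := by
    refine le_trans ?_ (aux_fit_bdd X y D μ hD hμ).1
    have h3 : 0 ≤ (X *ᵥ μ) ⬝ᵥ (X *ᵥ μ) := Finset.sum_nonneg fun i _ => mul_self_nonneg _
    rw [← Real.sq_sqrt h3]
    have : ‖X *ᵥ μ‖ ≤ √((X *ᵥ μ) ⬝ᵥ (X *ᵥ μ)) := by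
      refine (pi_norm_le_iff_of_nonneg (Real.sqrt_nonneg _)).2 fun i => ?_
      rw [Real.norm_eq_abs]
      apply Real.abs_le_sqrt
      rw [sq]
      exact Finset.single_le_sum (f := fun i => (X *ᵥ μ) i * (X *ᵥ μ) i)
        (fun i _ => mul_self_nonneg _) (Finset.mem_univ i)
    gcongr
  have h3 : μ j ^ 2 ≤ ‖μ‖ ^ 2 := by
    rw [← sq_abs]
    have := norm_le_pi_norm μ j
    rw [Real.norm_eq_abs] at this
    gcongr
  calc μ j ^ 2 ≤ ‖μ‖ ^ 2 := h3
    _ ≤ (C σ * ‖X *ᵥ μ‖) ^ 2 := by gcongr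
    _ = C σ ^ 2 * ‖X *ᵥ μ‖ ^ 2 := by ring
    _ ≤ C σ ^ 2 * (y ⬝ᵥ y) := by gcongr
    _ ≤ _ := Finset.single_le_sum (f := fun σ => C σ ^ 2 * (y ⬝ᵥ y))
        (fun i _ => mul_nonneg (sq_nonneg _) hyy) (Finset.mem_univ σ)

lemma aux_hsR {n p : ℕ} (X : Matrix (Fin n) (Fin p) ℝ) (y : Fin n → ℝ) (b : ℝ) {t : ℝ}
    (ht : 0 < t) {x : Fin p → ℝ} (hx : ∀ j, 0 < x j) :
    b ≤ hsR n p X y b t x ∧ hsR n p X y b t x ≤ (y ⬝ᵥ y) / 2 + b := by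
  have hD : ∀ j, 0 < (t * x j)⁻¹ := fun j => by have := hx j; positivity
  unfold hsR
  rw [aux_hsA X ht hx]
  set A := auxA X (fun j => (t * x j)⁻¹) with hA
  have h1 := aux_fit_bdd X y (fun j => (t * x j)⁻¹) (A⁻¹ *ᵥ (Xᵀ *ᵥ y)) hD (auxA_mulinv X hD _)
  have h2 : y ⬝ᵥ ((1 - X * A⁻¹ * X.transpose) *ᵥ y) =
      y ⬝ᵥ y - (X *ᵥ (A⁻¹ *ᵥ (Xᵀ *ᵥ y))) ⬝ᵥ y := by
    rw [Matrix.sub_mulVec, Matrix.one_mulVec, dotProduct_sub, dotProduct_comm y (_ *ᵥ y)]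
    simp only [Matrix.mulVec_mulVec, Matrix.mul_assoc]
  rw [h2]
  constructor <;> linarith [h1.1, h1.2.1, h1.2.2]

lemma aux_det {n p : ℕ} (X : Matrix (Fin n) (Fin p) ℝ) {x : Fin p → ℝ} (hx : ∀ j, 0 < x j) :
    ∃ l : Fin n → ℝ, (∀ i, 0 ≤ l i) ∧ ∀ t : ℝ,
      (1 + t • (X.transpose * X * Matrix.diagonal x)).det = ∏ i, (1 + t * l i) := by
  set S := X * Matrix.diagonal x * Xᵀ with hS
  have hSp : S.PosSemidef := by
    have := (Matrix.PosSemidef.diagonal (d := x) (fun j => (hx j).le)).mul_mul_conjTranspose_same X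
    simpa [hS] using this
  refine ⟨hSp.1.eigenvalues, hSp.eigenvalues_nonneg, ?_⟩
  intro t
  have h1 : (1 + t • (X.transpose * X * Matrix.diagonal x)).det = (1 + t • S).det := by
    have := Matrix.det_one_add_mul_comm (t • Xᵀ) (X * Matrix.diagonal x)
    rw [Matrix.smul_mul, Matrix.mul_smul, ← Matrix.mul_assoc] at this
    exact this
  rw [h1]
  conv_lhs => rw [hSp.1.spectral_theorem, Unitary.conjStarAlgAut_apply]
  set U := hSp.1.eigenvectorUnitary
  have hU : (U : Matrix (Fin n) (Fin n) ℝ) * star (U : Matrix (Fin n) (Fin n) ℝ) = 1 :=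
    Unitary.mul_star_self_of_mem U.2
  set Dg := Matrix.diagonal (RCLike.ofReal ∘ hSp.1.eigenvalues : Fin n → ℝ)
  have h2 : (1 : Matrix (Fin n) (Fin n) ℝ) + t • ((U : Matrix (Fin n) (Fin n) ℝ) * Dg *
      star (U : Matrix (Fin n) (Fin n) ℝ)) =
      (U : Matrix (Fin n) (Fin n) ℝ) * (1 + t • Dg) * star (U : Matrix (Fin n) (Fin n) ℝ) := by
    rw [Matrix.mul_add, Matrix.add_mul, Matrix.mul_one, hU, Matrix.mul_smul, Matrix.smul_mul]
  rw [h2, Matrix.det_mul_right_comm, hU, Matrix.one_mul]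
  have h3 : (1 : Matrix (Fin n) (Fin n) ℝ) + t • Dg =
      Matrix.diagonal (fun i => 1 + t * hSp.1.eigenvalues i) := by
    rw [← Matrix.diagonal_one, ← Matrix.diagonal_smul, Matrix.diagonal_add]
    rfl
  rw [h3, Matrix.det_diagonal]


lemma aux_ev_lt {G : ℝ → ℝ} {D : ℝ} (hG : HasDerivAt G D 0) (h0 : G 0 = 1) (hD : D < 0) {m : ℝ}
    (hm : 0 < m) : ∃ c, 0 < c ∧ c < m ∧ G c < 1 := by
  have h1 : Filter.Tendsto (slope G 0) (nhdsWithin 0 (Set.Ioi 0)) (nhds D) :=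
    (hasDerivAt_iff_tendsto_slope.1 hG).mono_left
      (nhdsWithin_mono _ fun x hx => ne_of_gt hx)
  have h2 := h1.eventually (Iio_mem_nhds hD)
  have h3 : ∀ᶠ c in nhdsWithin (0:ℝ) (Set.Ioi 0), c ∈ Set.Ioo 0 m := Ioo_mem_nhdsGT hm
  obtain ⟨c, hc, hc2⟩ := (h2.and h3).exists
  refine ⟨c, hc2.1, hc2.2, ?_⟩
  have hc' : slope G 0 c < 0 := hc
  rw [slope_def_field, h0, sub_zero] at hc'
  have := hc2.1
  by_contra hcon
  push Not at hcon
  have : 0 ≤ (G c - 1) / c := div_nonneg (by linarith) this.le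
  linarith

lemma aux_const_c {m : ℝ} (hm : 0 < m) :
    ∃ c, 0 < c ∧ c < m ∧ Real.Gamma (1 - c) * (2:ℝ) ^ (-c) < 1 := by
  refine aux_ev_lt (G := fun c => Real.Gamma (1 - c) * (2:ℝ) ^ (-c))
    (D := Real.eulerMascheroniConstant - Real.log 2) ?_ (by simp) ?_ hm
  · have h1 : HasDerivAt (fun c : ℝ => 1 - c) (-1) 0 := by
      simpa using (hasDerivAt_id (0:ℝ)).const_sub 1
    have h2 : HasDerivAt (fun c : ℝ => Real.Gamma (1 - c)) (-Real.eulerMascheroniConstant * -1) 0 :=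
      HasDerivAt.comp (0:ℝ) (h₂ := Real.Gamma) (by simpa using Real.hasDerivAt_Gamma_one) h1
    have h3 : HasDerivAt (fun c : ℝ => (2:ℝ) ^ (-c)) (-Real.log 2) 0 := by
      have := (hasDerivAt_neg (0:ℝ)).const_rpow (a := 2) (by norm_num)
      simpa using this
    refine HasDerivAt.congr_deriv (f := fun c => Real.Gamma (1 - c) * (2:ℝ) ^ (-c)) (h2.mul h3) ?_
    simp
    try ring
  · have := Real.log_two_gt_d9
    have := Real.eulerMascheroniConstant_lt_two_thirds
    linarith

lemma aux_const_d {m : ℝ} (hm : 0 < m) :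
    ∃ d, 0 < d ∧ d < m ∧ Real.Gamma (1 + d) * (Real.Gamma (1 - 7/8*d) * (auxκ d *
      ((2:ℝ) ^ (d/8) * (1 / (1 - d/4))))) < 1 := by
  refine aux_ev_lt (G := fun d => Real.Gamma (1 + d) * (Real.Gamma (1 - 7/8*d) * (auxκ d *
      ((2:ℝ) ^ (d/8) * (1 / (1 - d/4))))))
    (D := -Real.eulerMascheroniConstant + (Real.eulerMascheroniConstant * (7/8) +
      ((Real.log (7/8) * (7/8) + Real.log (1/8) / 8) + (Real.log 2 / 8 + 1/4)))) ?_
      (by simp [auxκ]) ?_ hm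
  · have i1 : HasDerivAt (fun c : ℝ => 1 + c) 1 0 := by
      simpa using (hasDerivAt_id (0:ℝ)).const_add 1
    have i2 : HasDerivAt (fun c : ℝ => 7/8 * c) (7/8) 0 := by
      simpa using (hasDerivAt_id (0:ℝ)).const_mul (7/8)
    have i3 : HasDerivAt (fun c : ℝ => c / 8) (1/8) 0 := by
      simpa using (hasDerivAt_id (0:ℝ)).div_const 8
    have i4 : HasDerivAt (fun c : ℝ => 1 - 7/8 * c) (-(7/8)) 0 := i2.const_sub 1
    have i5 : HasDerivAt (fun c : ℝ => 1 - c / 4) (-(1/4)) 0 := by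
      simpa using ((hasDerivAt_id (0:ℝ)).div_const 4).const_sub 1
    have g1 : HasDerivAt (fun c : ℝ => Real.Gamma (1 + c)) (-Real.eulerMascheroniConstant * 1) 0 :=
      HasDerivAt.comp (0:ℝ) (h₂ := Real.Gamma) (by simpa using Real.hasDerivAt_Gamma_one) i1
    have g2 : HasDerivAt (fun c : ℝ => Real.Gamma (1 - 7/8*c))
        (-Real.eulerMascheroniConstant * -(7/8)) 0 :=
      HasDerivAt.comp (0:ℝ) (h₂ := Real.Gamma) (by simpa using Real.hasDerivAt_Gamma_one) i4
    have g3 := i2.const_rpow (a := 7/8) (by norm_num)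
    have g4 := i3.const_rpow (a := 1/8) (by norm_num)
    have g5 := i3.const_rpow (a := 2) (by norm_num)
    have g6 : HasDerivAt (fun c : ℝ => 1 / (1 - c/4)) (1/4) 0 := by
      simp only [one_div]
      refine HasDerivAt.congr_deriv (f := fun c : ℝ => (1 - c/4)⁻¹) (i5.inv (by norm_num)) ?_
      norm_num
    refine HasDerivAt.congr_deriv (g1.mul (g2.mul ((g3.mul g4).mul (g5.mul g6)))) ?_
    simp [auxκ]
    ring
  · have e1 : Real.log (1/8) = -3 * Real.log 2 := by
      rw [show (1/8:ℝ) = (2^3)⁻¹ by norm_num, Real.log_inv, Real.log_pow]; push_cast; ring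
    have e2 : Real.log (7/8) ≤ -1/8 := by
      have := Real.log_le_sub_one_of_pos (x := 7/8) (by norm_num); linarith
    have := Real.log_two_gt_d9
    have := Real.one_half_lt_eulerMascheroniConstant
    rw [e1]
    linarith

/-- absorb lower powers -/
lemma aux_absorb {q d M ε : ℝ} (hq : 0 < q) (hqd : q < d) (hM : 0 ≤ M) (hε : 0 < ε) :
    ∃ C, 0 ≤ C ∧ ∀ x : ℝ, 0 < x → M * x ^ (-q) ≤ ε * x ^ (-d) + C := by
  set z : ℝ := (ε / (M + 1)) ^ (1 / (d - q)) with hz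
  have hzp : 0 < z := by positivity
  refine ⟨M * z ^ (-q), by positivity, fun x hx => ?_⟩
  rcases le_total z x with h | h
  · have h1 : x ^ (-q) ≤ z ^ (-q) := Real.rpow_le_rpow_of_nonpos hzp h (by linarith)
    have h2 : 0 ≤ ε * x ^ (-d) := by positivity
    nlinarith
  · have h1 : x ^ (d - q) ≤ ε / (M + 1) := by
      calc x ^ (d - q) ≤ z ^ (d - q) := Real.rpow_le_rpow hx.le h (by linarith)
        _ = _ := by
          rw [hz, ← Real.rpow_mul (by positivity), one_div, inv_mul_cancel₀ (by linarith),
            Real.rpow_one]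
    have h2 : x ^ (-q) = x ^ (d - q) * x ^ (-d) := by
      rw [← Real.rpow_add hx]; congr 1; ring
    have h3 : M * x ^ (d - q) ≤ ε := by
      rw [le_div_iff₀ (by linarith)] at h1
      have : 0 ≤ x ^ (d - q) := by positivity
      nlinarith
    have h4 : 0 ≤ M * z ^ (-q) := by positivity
    rw [h2, ← mul_assoc]
    have : 0 ≤ x ^ (-d) := by positivity
    nlinarith


lemma aux_meas_det {Ω : Type*} [MeasurableSpace Ω] {p : ℕ} {M : Ω → Matrix (Fin p) (Fin p) ℝ}
    (hM : ∀ i j, Measurable fun ω => M ω i j) : Measurable fun ω => (M ω).det := by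
  simp only [Matrix.det_apply]
  refine Finset.measurable_sum _ fun σ _ => ?_
  exact (Finset.measurable_prod _ fun i _ => hM _ _).const_smul _

lemma aux_meas_inv {Ω : Type*} [MeasurableSpace Ω] {p : ℕ} {M : Ω → Matrix (Fin p) (Fin p) ℝ}
    (hM : ∀ i j, Measurable fun ω => M ω i j) (i j : Fin p) :
    Measurable fun ω => (M ω)⁻¹ i j := by
  simp only [Matrix.inv_def, Ring.inverse_eq_inv', Matrix.smul_apply, smul_eq_mul,
    Matrix.adjugate_apply]
  refine (aux_meas_det hM).inv.mul (aux_meas_det fun k l => ?_)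
  simp only [Matrix.updateRow_apply]
  split_ifs
  · exact measurable_const
  · exact hM k l

lemma aux_meas_hsA {n p : ℕ} (X : Matrix (Fin n) (Fin p) ℝ) (x : Fin p → ℝ) (i j : Fin p) :
    Measurable fun t => hsA n p X t x i j := by
  unfold hsA
  simp only [Matrix.add_apply]
  refine measurable_const.add (aux_meas_inv (fun k l => ?_) i j)
  simp only [Matrix.smul_apply, smul_eq_mul]
  fun_prop

lemma aux_meas_hsAinv {n p : ℕ} (X : Matrix (Fin n) (Fin p) ℝ) (x : Fin p → ℝ) (i j : Fin p) :
    Measurable fun t => (hsA n p X t x)⁻¹ i j :=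
  aux_meas_inv (fun k l => aux_meas_hsA X x k l) i j

lemma aux_meas_mulVec {Ω : Type*} [MeasurableSpace Ω] {m p : ℕ} {M : Ω → Matrix (Fin m) (Fin p) ℝ}
    (hM : ∀ i j, Measurable fun ω => M ω i j) {v : Ω → Fin p → ℝ}
    (hv : ∀ j, Measurable fun ω => v ω j) (i : Fin m) :
    Measurable fun ω => (M ω *ᵥ v ω) i := by
  simp only [Matrix.mulVec, dotProduct]
  exact Finset.measurable_sum _ fun k _ => (hM _ _).mul (hv _)

lemma aux_meas_hsR {n p : ℕ} (X : Matrix (Fin n) (Fin p) ℝ) (y : Fin n → ℝ) (b : ℝ)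
    (x : Fin p → ℝ) : Measurable fun t => hsR n p X y b t x := by
  unfold hsR
  refine Measurable.add_const (Measurable.div_const ?_ 2) b
  simp only [dotProduct]
  refine Finset.measurable_sum _ fun i _ => measurable_const.mul ?_
  refine aux_meas_mulVec (v := fun _ => y) (fun k l => ?_) (fun _ => measurable_const) i
  simp only [Matrix.sub_apply, Matrix.mul_apply]
  refine measurable_const.sub (Finset.measurable_sum _ fun r _ => Measurable.mul ?_ measurable_const)
  exact Finset.measurable_sum _ fun s _ => measurable_const.mul (aux_meas_hsAinv X x s r)

lemma aux_meas_tau {n p : ℕ} (X : Matrix (Fin n) (Fin p) ℝ) (y : Fin n → ℝ) (a b : ℝ)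
    (x : Fin p → ℝ) {g : ℝ → ℝ} (hg : Measurable g) :
    Measurable (hsTauDens n p X y a b g x) := by
  unfold hsTauDens
  refine Measurable.mul (((aux_meas_hsR X y b x).pow_const _).mul (Measurable.pow_const ?_ _)) hg
  refine aux_meas_det fun i j => ?_
  simp only [Matrix.add_apply, Matrix.smul_apply, smul_eq_mul]
  fun_prop

lemma aux_tau {n p : ℕ} (X : Matrix (Fin n) (Fin p) ℝ) (y : Fin n → ℝ) {a b : ℝ} (ha : 0 < a)
    (hb : 0 < b) {g : ℝ → ℝ} (hg : Measurable g) (hg0 : ∀ t, 0 ≤ g t)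
    (hg1 : ∫ t in Set.Ioi (0:ℝ), g t = 1) {q e : ℝ} (hq : 0 < q) (hqe : q ≤ e)
    (hmom : IntegrableOn (fun t => t ^ e * g t) (Set.Ioi 0)) :
    ∃ M : ℝ, 0 ≤ M ∧ ∀ x : Fin p → ℝ, (∀ j, 0 < x j) →
      0 < ∫ u in Set.Ioi (0:ℝ), hsTauDens n p X y a b g x u ∧
      (∫⁻ t in Set.Ioi (0:ℝ), ENNReal.ofReal (hsTauDens n p X y a b g x t /
        ∫ u in Set.Ioi (0:ℝ), hsTauDens n p X y a b g x u) = 1) ∧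
      (∫⁻ t in Set.Ioi (0:ℝ), ENNReal.ofReal (t ^ q) * ENNReal.ofReal (hsTauDens n p X y a b g x t /
        ∫ u in Set.Ioi (0:ℝ), hsTauDens n p X y a b g x u) ≤ ENNReal.ofReal M) := by
  have hgi : IntegrableOn g (Set.Ioi 0) := by
    by_contra h
    rw [integral_undef h] at hg1
    norm_num at hg1
  obtain ⟨M, hMpos, hM⟩ : ∃ M : ℝ, 0 < M ∧ 1/2 ≤ ∫ t in Set.Ioc 0 M, g t := by
    have h := intervalIntegral_tendsto_integral_Ioi 0 hgi Filter.tendsto_id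
    rw [hg1] at h
    obtain ⟨M, hM1, hM2⟩ := ((h.eventually (Ioi_mem_nhds (show (1/2:ℝ) < 1 by norm_num))).and
      (Filter.eventually_gt_atTop 0)).exists
    refine ⟨M, hM2, ?_⟩
    rw [← intervalIntegral.integral_of_le hM2.le]
    exact le_of_lt hM1
  set α : ℝ := a + (n:ℝ)/2 with hα
  have hαp : 0 < α := by positivity
  have hyy : 0 ≤ y ⬝ᵥ y := Finset.sum_nonneg fun i _ => mul_self_nonneg _
  set ρ1 : ℝ := b ^ (-α) with hρ1
  set ρ0 : ℝ := ((y ⬝ᵥ y)/2 + b) ^ (-α) with hρ0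
  have hρ0p : 0 < ρ0 := by positivity
  have hρ1p : 0 < ρ1 := by positivity
  set m : ℝ := ∫ t in Set.Ioi (0:ℝ), t ^ e * g t with hm
  have hm0 : 0 ≤ m := setIntegral_nonneg measurableSet_Ioi fun t ht =>
    mul_nonneg (Real.rpow_nonneg (le_of_lt ht) _) (hg0 t)
  refine ⟨M ^ q + 2 * (ρ1 / ρ0) * (1 + m), by positivity, fun x hx => ?_⟩
  obtain ⟨l, hl0, hl⟩ := aux_det X hx
  set D : ℝ → ℝ := fun t => (∏ i, (1 + t * l i)) ^ (-(1/2:ℝ)) with hD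
  have hprod1 : ∀ t : ℝ, 0 ≤ t → 1 ≤ ∏ i, (1 + t * l i) := fun t ht => by
    have := Finset.prod_le_prod (s := Finset.univ) (f := fun _ : Fin n => (1:ℝ))
      (g := fun i => 1 + t * l i) (fun _ _ => by norm_num) (fun i _ => by
        have := mul_nonneg ht (hl0 i); linarith)
    simpa using this
  have hDp : ∀ t : ℝ, 0 ≤ t → 0 < D t := fun t ht =>
    Real.rpow_pos_of_pos (by linarith [hprod1 t ht]) _
  have hD1 : ∀ t : ℝ, 0 ≤ t → D t ≤ 1 := fun t ht =>
    Real.rpow_le_one_of_one_le_of_nonpos (hprod1 t ht) (by norm_num)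
  have hDanti : ∀ t u : ℝ, 0 ≤ t → t ≤ u → D u ≤ D t := fun t u ht htu => by
    refine Real.rpow_le_rpow_of_nonpos (by linarith [hprod1 t ht]) ?_ (by norm_num)
    refine Finset.prod_le_prod (fun i _ => by have := mul_nonneg ht (hl0 i); linarith) fun i _ => ?_
    have := mul_le_mul_of_nonneg_right htu (hl0 i)
    linarith
  set f := hsTauDens n p X y a b g x with hf
  have hfm : Measurable f := aux_meas_tau X y a b x hg
  have hfeq : ∀ t, f t = hsR n p X y b t x ^ (-α) * D t * g t := fun t => by
    simp only [hf, hsTauDens, hl, hD, hα]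
  clear_value D f
  have hρ : ∀ t : ℝ, 0 < t → ρ0 ≤ hsR n p X y b t x ^ (-α) ∧ hsR n p X y b t x ^ (-α) ≤ ρ1 := by
    intro t ht
    obtain ⟨h1, h2⟩ := aux_hsR X y b ht hx
    exact ⟨Real.rpow_le_rpow_of_nonpos (by linarith) h2 (by linarith),
      Real.rpow_le_rpow_of_nonpos hb h1 (by linarith)⟩
  have hf0 : ∀ t : ℝ, 0 < t → 0 ≤ f t := fun t ht => by
    rw [hfeq]
    exact mul_nonneg (mul_nonneg (hρ0p.le.trans (hρ t ht).1) (hDp t ht.le).le) (hg0 t)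
  have hfle : ∀ t : ℝ, 0 < t → f t ≤ ρ1 * D t * g t := fun t ht => by
    rw [hfeq]
    exact mul_le_mul_of_nonneg_right (mul_le_mul_of_nonneg_right (hρ t ht).2 (hDp t ht.le).le)
      (hg0 t)
  have hfge : ∀ t : ℝ, 0 < t → ρ0 * D t * g t ≤ f t := fun t ht => by
    rw [hfeq]
    exact mul_le_mul_of_nonneg_right (mul_le_mul_of_nonneg_right (hρ t ht).1 (hDp t ht.le).le)
      (hg0 t)
  have hfi : IntegrableOn f (Set.Ioi 0) := by
    refine Integrable.mono' (hgi.const_mul ρ1) hfm.aestronglyMeasurable ?_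
    refine (ae_restrict_mem measurableSet_Ioi).mono fun t ht => ?_
    rw [Real.norm_of_nonneg (hf0 t ht)]
    refine (hfle t ht).trans ?_
    have := mul_le_mul_of_nonneg_left (hD1 t (le_of_lt ht)) hρ1p.le
    rw [mul_one] at this
    exact mul_le_mul_of_nonneg_right this (hg0 t)
  set Z := ∫ u in Set.Ioi (0:ℝ), f u with hZ
  have hZge : ρ0 * D M / 2 ≤ Z := by
    calc ρ0 * D M / 2 ≤ ρ0 * D M * ∫ t in Set.Ioc 0 M, g t := by
          have := mul_pos hρ0p (hDp M hMpos.le)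
          nlinarith
      _ = ∫ t in Set.Ioc 0 M, ρ0 * D M * g t := by rw [integral_const_mul]
      _ ≤ ∫ t in Set.Ioc 0 M, f t := by
          refine setIntegral_mono_on ((hgi.mono_set Set.Ioc_subset_Ioi_self).const_mul _)
            (hfi.mono_set Set.Ioc_subset_Ioi_self) measurableSet_Ioc fun t ht => ?_
          refine le_trans ?_ (hfge t ht.1)
          exact mul_le_mul_of_nonneg_right (mul_le_mul_of_nonneg_left
            (hDanti t M ht.1.le ht.2) hρ0p.le) (hg0 t)
      _ ≤ Z := setIntegral_mono_set hfi
          ((ae_restrict_mem measurableSet_Ioi).mono fun t ht => hf0 t ht)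
          (Filter.Eventually.of_forall Set.Ioc_subset_Ioi_self)
  clear_value Z m ρ0 ρ1
  have hDM := hDp M hMpos.le
  have hZp : 0 < Z := lt_of_lt_of_le (by positivity) hZge
  refine ⟨hZp, ?_, ?_⟩
  · rw [← ofReal_integral_eq_lintegral_ofReal (hfi.div_const Z)
      ((ae_restrict_mem measurableSet_Ioi).mono fun t ht => div_nonneg (hf0 t ht) hZp.le),
      integral_div, ← hZ, div_self hZp.ne', ENNReal.ofReal_one]
  · set R : ℝ → ℝ := fun t => (M ^ q * f t + ρ1 * D M * (g t + t ^ e * g t)) / Z with hR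
    have hRi : IntegrableOn R (Set.Ioi 0) :=
      ((hfi.const_mul _).add ((hgi.add hmom).const_mul _)).div_const Z
    have hR0 : ∀ t : ℝ, 0 < t → 0 ≤ R t := fun t ht => by
      have := hf0 t ht
      have := hg0 t
      positivity
    have hle : ∀ t : ℝ, 0 < t → t ^ q * (f t / Z) ≤ R t := fun t ht => by
      rw [hR, mul_div_assoc']
      refine div_le_div_of_nonneg_right ?_ hZp.le
      have hft := hf0 t ht
      have hgt := hg0 t
      have htq : 0 < t ^ q := by positivity
      have hte : 0 < t ^ e := by positivity
      rcases le_total t M with h | h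
      · have h1 : t ^ q ≤ M ^ q := Real.rpow_le_rpow ht.le h hq.le
        have h2 : 0 ≤ ρ1 * D M * (g t + t ^ e * g t) := by positivity
        nlinarith
      · have h1 : t ^ q ≤ 1 + t ^ e := by
          rcases le_total t 1 with h' | h'
          · have := Real.rpow_le_one ht.le h' hq.le
            linarith
          · have := Real.rpow_le_rpow_of_exponent_le h' hqe
            linarith
        have h2 : f t ≤ ρ1 * D M * g t := (hfle t ht).trans
          (mul_le_mul_of_nonneg_right (mul_le_mul_of_nonneg_left (hDanti M t hMpos.le h) hρ1p.le)
            hgt)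
        have h3 : 0 ≤ M ^ q * f t := by positivity
        have h4 : t ^ q * f t ≤ (1 + t ^ e) * (ρ1 * D M * g t) := by gcongr
        nlinarith
    calc _ ≤ ∫⁻ t in Set.Ioi (0:ℝ), ENNReal.ofReal (R t) := by
          refine setLIntegral_mono' measurableSet_Ioi fun t ht => ?_
          rw [← ENNReal.ofReal_mul (Real.rpow_nonneg (le_of_lt ht) _)]
          exact ENNReal.ofReal_le_ofReal (hle t ht)
      _ = ENNReal.ofReal (∫ t in Set.Ioi (0:ℝ), R t) := by
          rw [ofReal_integral_eq_lintegral_ofReal hRi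
            ((ae_restrict_mem measurableSet_Ioi).mono fun t ht => hR0 t ht)]
      _ ≤ _ := by
          refine ENNReal.ofReal_le_ofReal ?_
          have : ∫ t in Set.Ioi (0:ℝ), R t = (M ^ q * Z + ρ1 * D M * (1 + m)) / Z := by
            have hgm : IntegrableOn (fun t => g t + t ^ e * g t) (Set.Ioi 0) := hgi.add hmom
            rw [hR, integral_div, integral_add (hfi.const_mul _) (hgm.const_mul _),
              integral_const_mul, integral_const_mul, integral_add hgi hmom, hg1,
              ← hZ, ← hm]
          rw [this, div_le_iff₀ hZp, add_mul]
          have h5 : ρ1 * D M ≤ 2 * (ρ1 / ρ0) * Z := by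
            calc ρ1 * D M = 2 * (ρ1 / ρ0) * (ρ0 * D M / 2) := by field_simp
              _ ≤ _ := by gcongr
          have h6 : 0 ≤ 1 + m := by linarith
          nlinarith


lemma aux_swap1 {A T : Type*} [MeasurableSpace A] [MeasurableSpace T] (μ : Measure A)
    (ν : Measure T) [SFinite μ] [SFinite ν] {F : A → T → ENNReal}
    (hF : Measurable fun z : A × T => F z.1 z.2) {w : T → ENNReal} (hw : Measurable w)
    {h : A → ENNReal} (hh : Measurable h) :
    ∫⁻ a, (∫⁻ t, F a t * w t ∂ν) * h a ∂μ = ∫⁻ t, (∫⁻ a, F a t * h a ∂μ) * w t ∂ν := by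
  have e1 : ∀ a, (∫⁻ t, F a t * w t ∂ν) * h a = ∫⁻ t, F a t * w t * h a ∂ν := fun a =>
    (lintegral_mul_const _ ((hF.comp measurable_prodMk_left).mul hw)).symm
  have e2 : ∀ t, (∫⁻ a, F a t * h a ∂μ) * w t = ∫⁻ a, F a t * w t * h a ∂μ := fun t => by
    rw [← lintegral_mul_const (f := fun a => F a t * h a) _
      ((hF.comp measurable_prodMk_right).mul hh)]
    refine lintegral_congr fun a => ?_
    ring
  simp only [e1, e2]
  refine lintegral_lintegral_swap (Measurable.aemeasurable ?_)
  exact (hF.mul (hw.comp measurable_snd)).mul (hh.comp measurable_fst)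

lemma aux_swap4 {A T N S B : Type*} [MeasurableSpace A] [MeasurableSpace T] [MeasurableSpace N]
    [MeasurableSpace S] [MeasurableSpace B] (μA : Measure A) (μT : Measure T) (μN : Measure N)
    (μS : Measure S) (μB : Measure B) [SFinite μA] [SFinite μT] [SFinite μN] [SFinite μS]
    [SFinite μB] {Φ : A → T → N → S → B → ENNReal}
    (hΦ : Measurable fun z : A × T × N × S × B => Φ z.1 z.2.1 z.2.2.1 z.2.2.2.1 z.2.2.2.2)
    {w3 : T → S → ENNReal} (h3 : Measurable fun z : T × S => w3 z.1 z.2)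
    {w4 : N → ENNReal} (h4 : Measurable w4) {w5 : T → ENNReal} (h5 : Measurable w5) :
    (Measurable fun a => ∫⁻ t, (∫⁻ n, (∫⁻ s, (∫⁻ b, Φ a t n s b ∂μB) * w3 t s ∂μS) * w4 n ∂μN) *
      w5 t ∂μT) ∧
    ∀ h : A → ENNReal, Measurable h →
    ∫⁻ a, (∫⁻ t, (∫⁻ n, (∫⁻ s, (∫⁻ b, Φ a t n s b ∂μB) * w3 t s ∂μS) * w4 n ∂μN) *
      w5 t ∂μT) * h a ∂μA =
    ∫⁻ t, (∫⁻ n, (∫⁻ s, (∫⁻ b, (∫⁻ a, Φ a t n s b * h a ∂μA) ∂μB) * w3 t s ∂μS) * w4 n ∂μN) *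
      w5 t ∂μT := by
  have m1 : Measurable fun z : A × T × N × S => ∫⁻ b, Φ z.1 z.2.1 z.2.2.1 z.2.2.2 b ∂μB := by
    refine Measurable.lintegral_prod_right'
      (f := fun z : (A × T × N × S) × B => Φ z.1.1 z.1.2.1 z.1.2.2.1 z.1.2.2.2 z.2) ?_
    exact hΦ.comp (f := fun z : (A × T × N × S) × B => (z.1.1, z.1.2.1, z.1.2.2.1, z.1.2.2.2, z.2))
      (by fun_prop)
  have m2 : Measurable fun z : A × T × N =>
      ∫⁻ s, (∫⁻ b, Φ z.1 z.2.1 z.2.2 s b ∂μB) * w3 z.2.1 s ∂μS := by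
    refine Measurable.lintegral_prod_right'
      (f := fun z : (A × T × N) × S => (∫⁻ b, Φ z.1.1 z.1.2.1 z.1.2.2 z.2 b ∂μB) *
        w3 z.1.2.1 z.2) ?_
    exact (m1.comp (f := fun z : (A × T × N) × S => (z.1.1, z.1.2.1, z.1.2.2, z.2))
      (by fun_prop)).mul (h3.comp (f := fun z : (A × T × N) × S => (z.1.2.1, z.2)) (by fun_prop))
  have m3 : Measurable fun z : A × T =>
      ∫⁻ n, (∫⁻ s, (∫⁻ b, Φ z.1 z.2 n s b ∂μB) * w3 z.2 s ∂μS) * w4 n ∂μN := by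
    refine Measurable.lintegral_prod_right'
      (f := fun z : (A × T) × N => (∫⁻ s, (∫⁻ b, Φ z.1.1 z.1.2 z.2 s b ∂μB) *
        w3 z.1.2 s ∂μS) * w4 z.2) ?_
    exact (m2.comp (f := fun z : (A × T) × N => (z.1.1, z.1.2, z.2))
      (by fun_prop)).mul (h4.comp measurable_snd)
  refine ⟨?_, fun h hh => ?_⟩
  · refine Measurable.lintegral_prod_right'
      (f := fun z : A × T => (∫⁻ n, (∫⁻ s, (∫⁻ b, Φ z.1 z.2 n s b ∂μB) *
        w3 z.2 s ∂μS) * w4 n ∂μN) * w5 z.2) ?_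
    exact m3.mul (h5.comp measurable_snd)
  · rw [aux_swap1 μA μT m3 h5 hh]
    refine lintegral_congr fun t => ?_
    congr 1
    rw [aux_swap1 μA μN (m2.comp (f := fun z : A × N => (z.1, t, z.2)) (by fun_prop)) h4 hh]
    refine lintegral_congr fun n => ?_
    congr 1
    rw [aux_swap1 μA μS (F := fun a s => ∫⁻ b, Φ a t n s b ∂μB) (w := w3 t) (m1.comp (f := fun z : A × S => (z.1, t, n, z.2)) (by fun_prop))
      (h3.comp (f := fun s => (t, s)) (by fun_prop)) hh]
    refine lintegral_congr fun s => ?_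
    congr 1
    have := aux_swap1 μA μB (F := fun a b => Φ a t n s b) (hΦ.comp (f := fun z : A × B => (z.1, t, n, s, z.2)) (by fun_prop))
      (measurable_const (a := (1 : ENNReal))) hh
    simpa using this

/-- The integrand of the innermost integral. -/
noncomputable def auxΦ {n p : ℕ} (X : Matrix (Fin n) (Fin p) ℝ) (y : Fin n → ℝ) (x : Fin p → ℝ)
    (x' : Fin p → ℝ) (t : ℝ) (ν : Fin p → ℝ) (s : ℝ) (β : Fin p → ℝ) : ENNReal :=
  (∏ j, ENNReal.ofReal (igDens 1 ((ν j)⁻¹ + (β j) ^ 2 / (2 * s * t)) (x' j))) *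
    ENNReal.ofReal (gaussDens p (hsA n p X t x)
              ((hsA n p X t x)⁻¹.mulVec (X.transpose.mulVec y)) s β)

lemma auxΦ_meas {n p : ℕ} (X : Matrix (Fin n) (Fin p) ℝ) (y : Fin n → ℝ) (x : Fin p → ℝ) :
    Measurable fun z : (Fin p → ℝ) × ℝ × (Fin p → ℝ) × ℝ × (Fin p → ℝ) =>
      auxΦ X y x z.1 z.2.1 z.2.2.1 z.2.2.2.1 z.2.2.2.2 := by
  unfold auxΦ
  refine Measurable.mul ?_ (Measurable.ennreal_ofReal ?_)
  · refine Finset.measurable_prod _ fun j _ => Measurable.ennreal_ofReal ?_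
    unfold igDens
    fun_prop
  · unfold gaussDens
    have hA : ∀ i j, Measurable fun z : (Fin p → ℝ) × ℝ × (Fin p → ℝ) × ℝ × (Fin p → ℝ) =>
        hsA n p X z.2.1 x i j := fun i j =>
      (aux_meas_hsA X x i j).comp (measurable_fst.comp measurable_snd)
    have hAi : ∀ i j, Measurable fun z : (Fin p → ℝ) × ℝ × (Fin p → ℝ) × ℝ × (Fin p → ℝ) =>
        (hsA n p X z.2.1 x)⁻¹ i j := fun i j =>
      (aux_meas_hsAinv X x i j).comp (measurable_fst.comp measurable_snd)
    have hv : ∀ i, Measurable fun z : (Fin p → ℝ) × ℝ × (Fin p → ℝ) × ℝ × (Fin p → ℝ) =>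
        (z.2.2.2.2 - (hsA n p X z.2.1 x)⁻¹ *ᵥ (Xᵀ *ᵥ y)) i := fun i => by
      simp only [Pi.sub_apply]
      refine Measurable.sub (by fun_prop) ?_
      exact aux_meas_mulVec (v := fun _ => Xᵀ *ᵥ y) hAi (fun _ => measurable_const) i
    refine Measurable.mul (Measurable.mul (by fun_prop) ((aux_meas_det hA).pow_const _)) ?_
    refine (Measurable.div (Measurable.neg ?_) (by fun_prop)).exp
    simp only [dotProduct]
    exact Finset.measurable_sum _ fun i _ => (hv i).mul (aux_meas_mulVec hA hv i)

/-- The Lebesgue-integral majorant of the transition density. -/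
noncomputable def auxK {n p : ℕ} (X : Matrix (Fin n) (Fin p) ℝ) (y : Fin n → ℝ) (a b : ℝ)
    (g : ℝ → ℝ) (x : Fin p → ℝ) (x' : Fin p → ℝ) : ENNReal :=
  ∫⁻ t in Set.Ioi (0:ℝ), (∫⁻ ν in Set.univ.pi (fun _ : Fin p => Set.Ioi (0 : ℝ)),
    (∫⁻ s in Set.Ioi (0:ℝ), (∫⁻ β : Fin p → ℝ, auxΦ X y x x' t ν s β) *
      ENNReal.ofReal (igDens (a + (n : ℝ) / 2) (hsR n p X y b t x) s)) *
      ∏ j, ENNReal.ofReal (igDens 1 (1 + (x j)⁻¹) (ν j))) *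
    ENNReal.ofReal (hsTauDens n p X y a b g x t /
      ∫ u in Set.Ioi (0 : ℝ), hsTauDens n p X y a b g x u)

lemma aux_ofReal_integral_le {Ω : Type*} [MeasurableSpace Ω] (μ : Measure Ω) (f : Ω → ℝ)
    (g : Ω → ENNReal) (hfg : ∀ᵐ ω ∂μ, ‖f ω‖ₑ ≤ g ω) :
    ‖∫ ω, f ω ∂μ‖ₑ ≤ ∫⁻ ω, g ω ∂μ :=
  (enorm_integral_le_lintegral_enorm f).trans (lintegral_mono_ae hfg)

lemma aux_enorm_ofReal {r : ℝ} (hr : 0 ≤ r) : ‖r‖ₑ = ENNReal.ofReal r := by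
  rw [← ofReal_norm, Real.norm_of_nonneg hr]

lemma auxK_bound {n p : ℕ} (X : Matrix (Fin n) (Fin p) ℝ) (y : Fin n → ℝ) {a b : ℝ} (ha : 0 < a)
    (hb : 0 < b) {g : ℝ → ℝ}
    {x : Fin p → ℝ} (hx : ∀ j, 0 < x j) {x' : Fin p → ℝ} (hx' : ∀ j, 0 < x' j)
    (hf : ∀ t, 0 < t → 0 ≤ hsTauDens n p X y a b g x t)
    (hZ : 0 < ∫ u in Set.Ioi (0:ℝ), hsTauDens n p X y a b g x u) :
    ENNReal.ofReal (hsMTD n p X y a b g x x') ≤ auxK X y a b g x x' := by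
  have hmp : MeasurableSet (Set.univ.pi (fun _ : Fin p => Set.Ioi (0 : ℝ))) :=
    MeasurableSet.univ_pi fun _ => measurableSet_Ioi
  refine (ENNReal.ofReal_le_ofReal (le_abs_self _)).trans ?_
  rw [← Real.norm_eq_abs, ofReal_norm]
  unfold hsMTD auxK
  refine aux_ofReal_integral_le _ _ _ ((ae_restrict_mem measurableSet_Ioi).mono fun t ht => ?_)
  have ht : 0 < t := ht
  rw [enorm_mul, aux_enorm_ofReal (div_nonneg (hf t ht) hZ.le)]
  gcongr
  refine aux_ofReal_integral_le _ _ _ ((ae_restrict_mem hmp).mono fun ν hν => ?_)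
  have hν : ∀ j, 0 < ν j := fun j => hν j (Set.mem_univ j)
  have hxx : ∀ j, 0 ≤ 1 + (x j)⁻¹ := fun j => by have := hx j; positivity
  rw [enorm_mul, aux_enorm_ofReal (Finset.prod_nonneg fun j _ =>
    aux_ig_nonneg one_pos (hxx j) (hν j).le), ENNReal.ofReal_prod_of_nonneg fun j _ =>
    aux_ig_nonneg one_pos (hxx j) (hν j).le]
  gcongr
  refine aux_ofReal_integral_le _ _ _ ((ae_restrict_mem measurableSet_Ioi).mono fun s hs => ?_)
  have hs : 0 < s := hs
  rw [enorm_mul, aux_enorm_ofReal (aux_ig_nonneg (by positivity)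
    (hb.le.trans (aux_hsR X y b ht hx).1) hs.le)]
  gcongr
  refine aux_ofReal_integral_le _ _ _ (Filter.Eventually.of_forall fun β => ?_)
  have hB : ∀ j, 0 ≤ (ν j)⁻¹ + (β j) ^ 2 / (2 * s * t) := fun j => by
    have := hν j; positivity
  have hG : 0 ≤ gaussDens p (hsA n p X t x)
              ((hsA n p X t x)⁻¹.mulVec (X.transpose.mulVec y)) s β := by
    have : 0 < (hsA n p X t x).det := by
      rw [aux_hsA X ht hx]
      exact (auxA_posDef X fun j => inv_pos.2 (mul_pos ht (hx j))).det_pos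
    unfold gaussDens
    positivity
  rw [enorm_mul, aux_enorm_ofReal hG, aux_enorm_ofReal (Finset.prod_nonneg fun j _ =>
    aux_ig_nonneg one_pos (hB j) (hx' j).le), ENNReal.ofReal_prod_of_nonneg fun j _ =>
    aux_ig_nonneg one_pos (hB j) (hx' j).le]
  exact le_rfl

lemma auxK_swap {n p : ℕ} (X : Matrix (Fin n) (Fin p) ℝ) (y : Fin n → ℝ) (a b : ℝ)
    {g : ℝ → ℝ} (hg : Measurable g) (x : Fin p → ℝ) :
    Measurable (auxK X y a b g x) ∧ ∀ h : (Fin p → ℝ) → ENNReal, Measurable h →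
    ∫⁻ x' in Set.univ.pi (fun _ : Fin p => Set.Ioi (0 : ℝ)), auxK X y a b g x x' * h x' =
    ∫⁻ t in Set.Ioi (0:ℝ), (∫⁻ ν in Set.univ.pi (fun _ : Fin p => Set.Ioi (0 : ℝ)),
    (∫⁻ s in Set.Ioi (0:ℝ), (∫⁻ β : Fin p → ℝ,
      ∫⁻ x' in Set.univ.pi (fun _ : Fin p => Set.Ioi (0 : ℝ)), auxΦ X y x x' t ν s β * h x') *
      ENNReal.ofReal (igDens (a + (n : ℝ) / 2) (hsR n p X y b t x) s)) *
      ∏ j, ENNReal.ofReal (igDens 1 (1 + (x j)⁻¹) (ν j))) *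
    ENNReal.ofReal (hsTauDens n p X y a b g x t /
      ∫ u in Set.Ioi (0 : ℝ), hsTauDens n p X y a b g x u) := by
  refine aux_swap4 (w3 := fun t s => ENNReal.ofReal (igDens (a + (n : ℝ) / 2) (hsR n p X y b t x) s))
    (w4 := fun ν => ∏ j, ENNReal.ofReal (igDens 1 (1 + (x j)⁻¹) (ν j))) (w5 := fun t =>
    ENNReal.ofReal (hsTauDens n p X y a b g x t /
      ∫ u in Set.Ioi (0 : ℝ), hsTauDens n p X y a b g x u)) _ _ _ _ _ (auxΦ_meas X y x) ?_ ?_ ?_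
  · have := (aux_meas_hsR X y b x)
    unfold igDens
    fun_prop
  · have := aux_ig_meas
    fun_prop
  · exact ((aux_meas_tau X y a b x hg).div_const _).ennreal_ofReal


lemma aux_avg {Ω : Type*} [MeasurableSpace Ω] (μ : Measure Ω) {w Y : Ω → ENNReal}
    (hw : Measurable w) (hY : Measurable Y) (h1 : ∫⁻ ω, w ω ∂μ ≤ 1) {m A B : ℝ} (hA : 0 ≤ A)
    (hB : 0 ≤ B) (hm : 0 ≤ m) (h2 : ∫⁻ ω, Y ω * w ω ∂μ ≤ ENNReal.ofReal m) :
    ∫⁻ ω, (ENNReal.ofReal A + ENNReal.ofReal B * Y ω) * w ω ∂μ ≤ ENNReal.ofReal (A + B * m) := by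
  have : ∀ ω, (ENNReal.ofReal A + ENNReal.ofReal B * Y ω) * w ω =
      ENNReal.ofReal A * w ω + ENNReal.ofReal B * (Y ω * w ω) := fun ω => by ring
  simp only [this]
  rw [lintegral_add_left (hw.const_mul _), lintegral_const_mul _ hw,
    lintegral_const_mul (f := fun ω => Y ω * w ω) _ (hY.mul hw), ENNReal.ofReal_add hA (by positivity), ENNReal.ofReal_mul hB]
  refine add_le_add ((mul_le_mul_right h1 _).trans (by simp)) (mul_le_mul_right h2 _)

lemma aux_ofReal_add_mul {A B z : ℝ} (hB : 0 ≤ B) :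
    ENNReal.ofReal (A + B * z) ≤ ENNReal.ofReal A + ENNReal.ofReal B * ENNReal.ofReal z := by
  rw [← ENNReal.ofReal_mul hB]
  exact ENNReal.ofReal_add_le

lemma aux_inner {n p : ℕ} (X : Matrix (Fin n) (Fin p) ℝ) (y : Fin n → ℝ) {x : Fin p → ℝ}
    (hx : ∀ j, 0 < x j) {t s e : ℝ} (ht : 0 < t) (hs : 0 < s) {ν : Fin p → ℝ} (hν : ∀ j, 0 < ν j)
    (he : e < 1) (j : Fin p) :
    ∫⁻ β : Fin p → ℝ, ∫⁻ x' in Set.univ.pi (fun _ : Fin p => Set.Ioi (0 : ℝ)),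
      auxΦ X y x x' t ν s β * ENNReal.ofReal (x' j ^ e) =
    ∫⁻ w, ENNReal.ofReal (((ν j)⁻¹ + w ^ 2 / (2 * s * t)) ^ e * Real.Gamma (1 - e))
      ∂ProbabilityTheory.gaussianReal (((hsA n p X t x)⁻¹ *ᵥ (Xᵀ *ᵥ y)) j)
        (s * (hsA n p X t x)⁻¹ j j).toNNReal := by
  have hA : (hsA n p X t x).PosDef := by
    rw [aux_hsA X ht hx]
    exact auxA_posDef X fun j => inv_pos.2 (mul_pos ht (hx j))
  rw [← aux_gauss_marg (hsA n p X t x) hA _ hs j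
    (fun w => ENNReal.ofReal (((ν j)⁻¹ + w ^ 2 / (2 * s * t)) ^ e * Real.Gamma (1 - e)))
    (by fun_prop)]
  refine lintegral_congr fun β => ?_
  have hB : ∀ i, 0 < (ν i)⁻¹ + (β i) ^ 2 / (2 * s * t) := fun i => by
    have := hν i; positivity
  have hm : Measurable fun x' : Fin p → ℝ => ENNReal.ofReal (x' j ^ e) *
      ∏ i, ENNReal.ofReal (igDens 1 ((ν i)⁻¹ + (β i) ^ 2 / (2 * s * t)) (x' i)) := by
    have := aux_ig_meas
    fun_prop
  calc _ = ∫⁻ x' in Set.univ.pi (fun _ : Fin p => Set.Ioi (0 : ℝ)),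
        ENNReal.ofReal (gaussDens p (hsA n p X t x)
              ((hsA n p X t x)⁻¹.mulVec (X.transpose.mulVec y)) s β) *
        (ENNReal.ofReal (x' j ^ e) *
          ∏ i, ENNReal.ofReal (igDens 1 ((ν i)⁻¹ + (β i) ^ 2 / (2 * s * t)) (x' i))) := by
        refine lintegral_congr fun x' => ?_
        unfold auxΦ
        ring
    _ = _ := by
        rw [lintegral_const_mul _ hm, aux_pi_ig (fun i => (ν i)⁻¹ + (β i) ^ 2 / (2 * s * t)) hB j
          (fun u => ENNReal.ofReal (u ^ e)) (by fun_prop), aux_ig_moment one_pos (hB j) he]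
        simp

lemma aux_nu {p : ℕ} {x : Fin p → ℝ} (hx : ∀ j, 0 < x j) (j : Fin p) {e : ℝ} (he : e < 1) :
    ∫⁻ ν in Set.univ.pi (fun _ : Fin p => Set.Ioi (0 : ℝ)), ENNReal.ofReal (ν j ^ e) *
      ∏ i, ENNReal.ofReal (igDens 1 (1 + (x i)⁻¹) (ν i)) =
    ENNReal.ofReal ((1 + (x j)⁻¹) ^ e * Real.Gamma (1 - e)) := by
  have hB : ∀ i, 0 < 1 + (x i)⁻¹ := fun i => by have := hx i; positivity
  rw [aux_pi_ig (fun i => 1 + (x i)⁻¹) hB j (fun u => ENNReal.ofReal (u ^ e)) (by fun_prop),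
    aux_ig_moment one_pos (hB j) he]
  simp

lemma aux_pos_real {T c C m v s t x : ℝ} (hT : 0 < T) (hc : 0 < c) (hc1 : c < 1/2) (hC0 : 0 ≤ C)
    (hμC : m ^ 2 ≤ C) (hv0 : 0 < v) (hv1 : v ≤ t * x) (hs : 0 < s) (htT : T ≤ t) (hx : 0 < x) :
    (2 * s * t) ^ (-c) * (m ^ 2 + s * v) ^ c ≤
      2 ^ (-c) * x ^ c + (C / (2 * T)) ^ c * s ^ (-c) := by
  have ht : 0 < t := hT.trans_le htT
  have e1 : (2 * s * t) ^ (-c) * (m ^ 2 + s * v) ^ c =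
      ((m ^ 2 + s * v) / (2 * s * t)) ^ c := by
    rw [Real.div_rpow (by positivity) (by positivity), Real.rpow_neg (by positivity)]
    field_simp
  have e2 : (m ^ 2 + s * v) / (2 * s * t) ≤ x / 2 + C / (2 * T) / s := by
    have h1 : s * v / (2 * s * t) ≤ x / 2 := by
      rw [div_le_div_iff₀ (by positivity) (by positivity)]
      nlinarith
    have h2 : m ^ 2 / (2 * s * t) ≤ C / (2 * T) / s := by
      rw [div_div]
      refine div_le_div₀ hC0 hμC (by positivity) ?_
      nlinarith
    rw [add_div]; linarith
  rw [e1]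
  calc _ ≤ (x / 2 + C / (2 * T) / s) ^ c :=
        Real.rpow_le_rpow (by positivity) e2 hc.le
    _ ≤ (x / 2) ^ c + (C / (2 * T) / s) ^ c :=
        Real.rpow_add_le_add_rpow (by positivity) (by positivity) hc.le (by linarith)
    _ = _ := by
        rw [Real.div_rpow (by positivity) (by norm_num),
          Real.div_rpow (by positivity) hs.le, Real.rpow_neg (by norm_num),
          Real.rpow_neg hs.le]
        ring

lemma aux_pos {n p : ℕ} (X : Matrix (Fin n) (Fin p) ℝ) (y : Fin n → ℝ) {a b : ℝ} (ha : 0 < a)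
    (hb : 0 < b) {T c : ℝ} (hT : 0 < T) (hc : 0 < c) (hc1 : c < 1/2) :
    ∃ K : ℝ, 0 ≤ K ∧ ∀ g : ℝ → ℝ, Measurable g → (∀ t, t < T → g t = 0) →
      ∀ x : Fin p → ℝ, (∀ j, 0 < x j) →
      (∫⁻ t in Set.Ioi (0:ℝ), ENNReal.ofReal (hsTauDens n p X y a b g x t /
        ∫ u in Set.Ioi (0:ℝ), hsTauDens n p X y a b g x u) = 1) → ∀ j,
      ∫⁻ x' in Set.univ.pi (fun _ : Fin p => Set.Ioi (0 : ℝ)),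
        auxK X y a b g x x' * ENNReal.ofReal (x' j ^ c) ≤
      ENNReal.ofReal (Real.Gamma (1 - c) * 2 ^ (-c) * x j ^ c + K) := by
  obtain ⟨C, hC0, hC⟩ := aux_mu_bdd X y
  set α : ℝ := a + (n:ℝ)/2 with hα
  have hαp : 0 < α := by positivity
  set Γ1 := Real.Gamma (1 - c) with hΓ1
  have hΓ1p : 0 < Γ1 := Real.Gamma_pos_of_pos (by linarith)
  set Γ2 := Real.Gamma (1 + c) with hΓ2
  have hΓ2p : 0 < Γ2 := Real.Gamma_pos_of_pos (by linarith)
  set S : ℝ := b ^ (-c) * (Real.Gamma (α + c) / Real.Gamma α) with hS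
  have hSp : 0 < S := by
    have := Real.Gamma_pos_of_pos hαp
    have := Real.Gamma_pos_of_pos (show 0 < α + c by linarith)
    positivity
  set K1 : ℝ := (C / (2 * T)) ^ c with hK1
  have hK1p : 0 ≤ K1 := by positivity
  clear_value Γ1 Γ2 S K1
  refine ⟨Γ1 * K1 * S + Γ1 * Γ2, by positivity, ?_⟩
  intro g hg hgT x hx hmass j
  have hmp : MeasurableSet (Set.univ.pi (fun _ : Fin p => Set.Ioi (0 : ℝ))) :=
    MeasurableSet.univ_pi fun _ => measurableSet_Ioi
  rw [(auxK_swap X y a b hg x).2 _ (by fun_prop)]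
  have hxj := hx j
  have hxc : 0 < x j ^ c := by positivity
  set R : ℝ := Γ1 * 2 ^ (-c) * x j ^ c + (Γ1 * K1 * S + Γ1 * Γ2) with hR
  have hRp : 0 ≤ R := by positivity
  have key : ∀ t ∈ Set.Ioi (0:ℝ), T ≤ t →
      (∫⁻ ν in Set.univ.pi (fun _ : Fin p => Set.Ioi (0 : ℝ)),
      (∫⁻ s in Set.Ioi (0:ℝ), (∫⁻ β : Fin p → ℝ,
      ∫⁻ x' in Set.univ.pi (fun _ : Fin p => Set.Ioi (0 : ℝ)), auxΦ X y x x' t ν s β *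
        ENNReal.ofReal (x' j ^ c)) *
      ENNReal.ofReal (igDens α (hsR n p X y b t x) s)) *
      ∏ j, ENNReal.ofReal (igDens 1 (1 + (x j)⁻¹) (ν j))) ≤ ENNReal.ofReal R := by
    intro t ht htT
    have ht : 0 < t := ht
    have hD : ∀ j, 0 < (t * x j)⁻¹ := fun j => inv_pos.2 (mul_pos ht (hx j))
    have hAe := aux_hsA X ht hx
    obtain ⟨hv0, hv1, -⟩ := auxA_inv_diag X hD j
    rw [← hAe] at hv0 hv1
    rw [inv_inv] at hv1
    set μ := (hsA n p X t x)⁻¹ *ᵥ (Xᵀ *ᵥ y) with hμ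
    have hμC : μ j ^ 2 ≤ C := by
      refine hC _ hD μ ?_ j
      rw [hμ, hAe, auxA_mulinv X hD]
    set v := (hsA n p X t x)⁻¹ j j with hv
    clear_value v μ
    obtain ⟨hr1, hr2⟩ := aux_hsR X y b ht hx
    have hrp : 0 < hsR n p X y b t x := hb.trans_le hr1
    have hin : ∀ ν ∈ Set.univ.pi (fun _ : Fin p => Set.Ioi (0 : ℝ)), ∀ s ∈ Set.Ioi (0:ℝ),
        (∫⁻ β : Fin p → ℝ, ∫⁻ x' in Set.univ.pi (fun _ : Fin p => Set.Ioi (0 : ℝ)),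
          auxΦ X y x x' t ν s β * ENNReal.ofReal (x' j ^ c)) ≤
        ENNReal.ofReal (Γ1 * (ν j ^ (-c)) + Γ1 * 2 ^ (-c) * x j ^ c) +
          ENNReal.ofReal (Γ1 * K1) * ENNReal.ofReal (s ^ (-c)) := by
      intro ν hν s hs
      have hν : ∀ j, 0 < ν j := fun j => hν j (Set.mem_univ j)
      have hs : 0 < s := hs
      have hνj := hν j
      rw [aux_inner X y hx ht hs hν (by linarith) j, ← hμ, ← hv, ← hΓ1]
      have hsv : 0 < s * v := mul_pos hs hv0
      calc _ ≤ ∫⁻ w, (ENNReal.ofReal (Γ1 * ν j ^ (-c)) +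
              ENNReal.ofReal (Γ1 * (2 * s * t) ^ (-c)) * ENNReal.ofReal ((w ^ 2) ^ c))
              ∂ProbabilityTheory.gaussianReal (μ j) (s * v).toNNReal := by
            refine lintegral_mono fun w => ?_
            refine le_trans (ENNReal.ofReal_le_ofReal ?_) (aux_ofReal_add_mul (by positivity))
            have h1 : ((ν j)⁻¹ + w ^ 2 / (2 * s * t)) ^ c ≤
                ((ν j)⁻¹) ^ c + (w ^ 2 / (2 * s * t)) ^ c :=
              Real.rpow_add_le_add_rpow (by positivity) (by positivity) hc.le (by linarith)
            rw [Real.inv_rpow hνj.le, ← Real.rpow_neg hνj.le, div_eq_mul_inv,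
              Real.mul_rpow (by positivity) (by positivity), Real.inv_rpow (by positivity),
              ← Real.rpow_neg (by positivity)] at h1
            rw [← div_eq_mul_inv] at h1
            nlinarith
        _ ≤ ENNReal.ofReal (Γ1 * ν j ^ (-c)) + ENNReal.ofReal (Γ1 * (2 * s * t) ^ (-c)) *
              ENNReal.ofReal ((μ j ^ 2 + s * v) ^ c) := by
            rw [lintegral_add_left measurable_const, lintegral_const, measure_univ, mul_one,
              lintegral_const_mul _ (by fun_prop)]
            gcongr
            have := aux_gauss_pos (μ j) (s * v).toNNReal (c := c)
              (by rw [Real.coe_toNNReal _ hsv.le]; exact hsv) (by linarith) (by linarith)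
            rwa [Real.coe_toNNReal _ hsv.le] at this
        _ ≤ _ := by
            have hK := aux_pos_real hT hc hc1 hC0 hμC hv0 hv1 hs htT hxj
            rw [← hK1] at hK
            rw [← ENNReal.ofReal_mul (by positivity), ← ENNReal.ofReal_mul (by positivity),
              ← ENNReal.ofReal_add (by positivity) (by positivity),
              ← ENNReal.ofReal_add (by positivity) (by positivity)]
            refine ENNReal.ofReal_le_ofReal ?_
            nlinarith
    calc _ ≤ ∫⁻ ν in Set.univ.pi (fun _ : Fin p => Set.Ioi (0 : ℝ)),
          (ENNReal.ofReal (Γ1 * 2 ^ (-c) * x j ^ c + Γ1 * K1 * S) +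
            ENNReal.ofReal Γ1 * ENNReal.ofReal (ν j ^ (-c))) *
          ∏ j, ENNReal.ofReal (igDens 1 (1 + (x j)⁻¹) (ν j)) := by
          refine setLIntegral_mono' hmp fun ν hν => ?_
          gcongr
          have hνj : 0 < ν j := hν j (Set.mem_univ j)
          calc _ ≤ ∫⁻ s in Set.Ioi (0:ℝ),
                (ENNReal.ofReal (Γ1 * (ν j ^ (-c)) + Γ1 * 2 ^ (-c) * x j ^ c) +
                ENNReal.ofReal (Γ1 * K1) * ENNReal.ofReal (s ^ (-c))) *
                ENNReal.ofReal (igDens α (hsR n p X y b t x) s) := by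
                refine setLIntegral_mono' measurableSet_Ioi fun s hs => ?_
                gcongr
                exact hin ν hν s hs
            _ ≤ ENNReal.ofReal ((Γ1 * (ν j ^ (-c)) + Γ1 * 2 ^ (-c) * x j ^ c) +
                  (Γ1 * K1) * S) := by
                refine aux_avg _ (aux_ig_meas _ _).ennreal_ofReal (by fun_prop)
                  (aux_ig_mass hαp hrp).le (by positivity) (by positivity) hSp.le ?_
                rw [aux_ig_moment hαp hrp (by linarith)]
                refine ENNReal.ofReal_le_ofReal ?_
                rw [sub_neg_eq_add, hS]
                have := Real.Gamma_pos_of_pos hαp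
                have := Real.Gamma_pos_of_pos (show 0 < α + c by linarith)
                refine mul_le_mul_of_nonneg_right ?_ (by positivity)
                exact Real.rpow_le_rpow_of_nonpos hb hr1 (by linarith)
            _ ≤ _ := by
                rw [← ENNReal.ofReal_mul hΓ1p.le, ← ENNReal.ofReal_add (by positivity)
                  (by positivity)]
                exact ENNReal.ofReal_le_ofReal (by linarith)
      _ ≤ ENNReal.ofReal ((Γ1 * 2 ^ (-c) * x j ^ c + Γ1 * K1 * S) + Γ1 * Γ2) := by
          have hmeas : Measurable fun ν : Fin p → ℝ =>
              ∏ j, ENNReal.ofReal (igDens 1 (1 + (x j)⁻¹) (ν j)) := by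
            have := aux_ig_meas
            fun_prop
          refine aux_avg _ hmeas (by fun_prop) ?_ (by positivity) hΓ1p.le hΓ2p.le ?_
          · have := aux_nu hx j (e := 0) (by norm_num)
            simp at this
            exact this.le
          · rw [aux_nu hx j (by linarith)]
            refine ENNReal.ofReal_le_ofReal ?_
            rw [sub_neg_eq_add, ← hΓ2]
            have : (1 + (x j)⁻¹) ^ (-c) ≤ 1 := Real.rpow_le_one_of_one_le_of_nonpos
              (by have := inv_pos.2 hxj; linarith) (by linarith)
            nlinarith
      _ = _ := by rw [hR]; congr 1; ring
  calc _ ≤ ∫⁻ t in Set.Ioi (0:ℝ), ENNReal.ofReal R *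
        ENNReal.ofReal (hsTauDens n p X y a b g x t /
          ∫ u in Set.Ioi (0:ℝ), hsTauDens n p X y a b g x u) := by
        refine setLIntegral_mono' measurableSet_Ioi fun t ht => ?_
        rcases lt_or_ge t T with h | h
        · have : hsTauDens n p X y a b g x t = 0 := by simp [hsTauDens, hgT t h]
          simp [this]
        · gcongr
          exact key t ht h
    _ = _ := by
        rw [lintegral_const_mul _ ((aux_meas_tau X y a b x hg).div_const _).ennreal_ofReal, hmass,
          mul_one]


lemma aux_neg_real {d v s t x L nu : ℝ} (hd : 0 < d) (hd1 : d < 1/2) (hL : 0 ≤ L)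
    (hv0 : 0 < v) (hv1 : 1 ≤ v * (L + (t * x)⁻¹)) (hs : 0 < s) (ht : 0 < t) (hx : 0 < x)
    (hnu : 0 < nu) :
    auxκ d * (nu⁻¹) ^ (-(7/8*d)) * (((2 * s * t)⁻¹) ^ (-(d/8)) *
      ((s * v) ^ (-(d/8)) * (1 / (1 - d/4)))) ≤
    auxκ d * (2 ^ (d/8) * (1 / (1 - d/4))) * (x ^ (-(d/8)) + L ^ (d/8) * t ^ (d/8)) *
      nu ^ (7/8*d) := by
  have hq : 0 < d/8 := by positivity
  have hκ : 0 < auxκ d := by unfold auxκ; positivity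
  have h4 : 0 < 1 / (1 - d/4) := by
    have : 0 < 1 - d/4 := by linarith
    positivity
  have e1 : (nu⁻¹) ^ (-(7/8*d)) = nu ^ (7/8*d) := by
    rw [Real.inv_rpow hnu.le, Real.rpow_neg hnu.le, inv_inv]
  have e2 : ((2 * s * t)⁻¹) ^ (-(d/8)) * (s * v) ^ (-(d/8)) = 2 ^ (d/8) * (t / v) ^ (d/8) := by
    rw [← Real.mul_rpow (by positivity) (by positivity), ← Real.mul_rpow (by positivity)
      (by positivity), Real.rpow_neg (by positivity), ← Real.inv_rpow (by positivity)]
    congr 1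
    field_simp
  have e3 : (t / v) ^ (d/8) ≤ x ^ (-(d/8)) + L ^ (d/8) * t ^ (d/8) := by
    have : t / v ≤ x⁻¹ + L * t := by
      rw [div_le_iff₀ hv0]
      calc t ≤ t * (v * (L + (t * x)⁻¹)) := le_mul_of_one_le_right ht.le hv1
        _ = (x⁻¹ + L * t) * v := by field_simp; ring
    calc _ ≤ (x⁻¹ + L * t) ^ (d/8) := Real.rpow_le_rpow (by positivity) this hq.le
      _ ≤ (x⁻¹) ^ (d/8) + (L * t) ^ (d/8) :=
        Real.rpow_add_le_add_rpow (by positivity) (by positivity) hq.le (by linarith)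
      _ = _ := by
        rw [Real.inv_rpow hx.le, ← Real.rpow_neg hx.le, Real.mul_rpow hL ht.le]
  calc _ = auxκ d * (2 ^ (d/8) * (1 / (1 - d/4))) * nu ^ (7/8*d) * (t / v) ^ (d/8) := by
        rw [e1, ← mul_assoc (((2 * s * t)⁻¹) ^ (-(d/8))), e2]; ring
    _ ≤ auxκ d * (2 ^ (d/8) * (1 / (1 - d/4))) * nu ^ (7/8*d) *
        (x ^ (-(d/8)) + L ^ (d/8) * t ^ (d/8)) := by
        refine mul_le_mul_of_nonneg_left e3 (by positivity)
    _ = _ := by ring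

lemma aux_neg {n p : ℕ} (X : Matrix (Fin n) (Fin p) ℝ) (y : Fin n → ℝ) {a b : ℝ} (ha : 0 < a)
    (hb : 0 < b) {T d M : ℝ} (hT : 0 < T) (hd : 0 < d) (hd1 : d < 1/2) (hM : 0 ≤ M)
    {g : ℝ → ℝ} (hg : Measurable g) (hgT : ∀ t, t < T → g t = 0)
    {x : Fin p → ℝ} (hx : ∀ j, 0 < x j)
    (hmass : ∫⁻ t in Set.Ioi (0:ℝ), ENNReal.ofReal (hsTauDens n p X y a b g x t /
        ∫ u in Set.Ioi (0:ℝ), hsTauDens n p X y a b g x u) = 1)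
    (hmom : ∫⁻ t in Set.Ioi (0:ℝ), ENNReal.ofReal (t ^ (d/8)) *
      ENNReal.ofReal (hsTauDens n p X y a b g x t /
        ∫ u in Set.Ioi (0:ℝ), hsTauDens n p X y a b g x u) ≤ ENNReal.ofReal M) (j : Fin p) :
    ∫⁻ x' in Set.univ.pi (fun _ : Fin p => Set.Ioi (0 : ℝ)),
        auxK X y a b g x x' * ENNReal.ofReal (x' j ^ (-d)) ≤
      ENNReal.ofReal (Real.Gamma (1 + d) * (Real.Gamma (1 - 7/8*d) * (auxκ d *
      ((2:ℝ) ^ (d/8) * (1 / (1 - d/4))))) * (1 + x j ^ (-(7/8*d))) *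
        (x j ^ (-(d/8)) + ((Xᵀ * X) j j) ^ (d/8) * M)) := by
  set α : ℝ := a + (n:ℝ)/2 with hα
  have hαp : 0 < α := by positivity
  set Γ1 := Real.Gamma (1 - 7/8*d) with hΓ1
  have hΓ1p : 0 < Γ1 := Real.Gamma_pos_of_pos (by linarith)
  set Γ2 := Real.Gamma (1 + d) with hΓ2
  have hΓ2p : 0 < Γ2 := Real.Gamma_pos_of_pos (by linarith)
  set H : ℝ := auxκ d * ((2:ℝ) ^ (d/8) * (1 / (1 - d/4))) with hH
  have hHp : 0 < H := by
    have : 0 < 1 - d/4 := by linarith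
    have hκ : 0 < auxκ d := by unfold auxκ; positivity
    positivity
  set L : ℝ := (Xᵀ * X) j j with hL
  have hL0 : 0 ≤ L := by
    rw [hL, Matrix.mul_apply]
    exact Finset.sum_nonneg fun i _ => mul_self_nonneg _
  clear_value Γ1 Γ2
  have hxj := hx j
  set xq := x j ^ (-(d/8)) with hxq
  have hxq0 : 0 < xq := by positivity
  set xt := x j ^ (-(7/8*d)) with hxt
  have hxt0 : 0 < xt := by positivity
  have hmp : MeasurableSet (Set.univ.pi (fun _ : Fin p => Set.Ioi (0 : ℝ))) :=
    MeasurableSet.univ_pi fun _ => measurableSet_Ioi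
  set Lq := L ^ (d/8) with hLq
  have hLq0 : 0 ≤ Lq := by positivity
  rw [(auxK_swap X y a b hg x).2 _ (by fun_prop)]
  have key : ∀ t ∈ Set.Ioi (0:ℝ), T ≤ t →
      (∫⁻ ν in Set.univ.pi (fun _ : Fin p => Set.Ioi (0 : ℝ)),
      (∫⁻ s in Set.Ioi (0:ℝ), (∫⁻ β : Fin p → ℝ,
      ∫⁻ x' in Set.univ.pi (fun _ : Fin p => Set.Ioi (0 : ℝ)), auxΦ X y x x' t ν s β *
        ENNReal.ofReal (x' j ^ (-d))) *
      ENNReal.ofReal (igDens α (hsR n p X y b t x) s)) *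
      ∏ j, ENNReal.ofReal (igDens 1 (1 + (x j)⁻¹) (ν j))) ≤
      ENNReal.ofReal (Γ2 * (Γ1 * H) * (1 + xt) * (xq + Lq * t ^ (d/8))) := by
    intro t ht htT
    have ht : 0 < t := ht
    have htq : 0 < t ^ (d/8) := by positivity
    have hD : ∀ j, 0 < (t * x j)⁻¹ := fun j => inv_pos.2 (mul_pos ht (hx j))
    have hAe := aux_hsA X ht hx
    obtain ⟨hv0, -, hv1⟩ := auxA_inv_diag X hD j
    rw [← hAe] at hv0 hv1
    have hAjj : hsA n p X t x j j = L + (t * x j)⁻¹ := by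
      rw [hAe]; simp [auxA, hL]
    rw [hAjj] at hv1
    set μ := (hsA n p X t x)⁻¹ *ᵥ (Xᵀ *ᵥ y) with hμ
    set v := (hsA n p X t x)⁻¹ j j with hv
    clear_value v μ
    obtain ⟨hr1, hr2⟩ := aux_hsR X y b ht hx
    have hrp : 0 < hsR n p X y b t x := hb.trans_le hr1
    set W : ℝ := Γ2 * H * (xq + Lq * t ^ (d/8)) with hW
    have hW0 : 0 ≤ W := by
      have := mul_nonneg hLq0 htq.le
      have : 0 ≤ xq + Lq * t ^ (d/8) := by linarith
      exact mul_nonneg (mul_pos hΓ2p hHp).le this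
    have hin : ∀ ν ∈ Set.univ.pi (fun _ : Fin p => Set.Ioi (0 : ℝ)), ∀ s ∈ Set.Ioi (0:ℝ),
        (∫⁻ β : Fin p → ℝ, ∫⁻ x' in Set.univ.pi (fun _ : Fin p => Set.Ioi (0 : ℝ)),
          auxΦ X y x x' t ν s β * ENNReal.ofReal (x' j ^ (-d))) ≤
        ENNReal.ofReal W * ENNReal.ofReal (ν j ^ (7/8*d)) := by
      intro ν hν s hs
      have hν : ∀ j, 0 < ν j := fun j => hν j (Set.mem_univ j)
      have hs : 0 < s := hs
      have hνj := hν j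
      rw [aux_inner X y hx ht hs hν (by linarith) j, ← hμ, ← hv, sub_neg_eq_add, ← hΓ2]
      have hsv : 0 < s * v := mul_pos hs hv0
      calc _ = ENNReal.ofReal Γ2 * ∫⁻ w,
              ENNReal.ofReal (((ν j)⁻¹ + w ^ 2 * (2 * s * t)⁻¹) ^ (-d))
              ∂ProbabilityTheory.gaussianReal (μ j) (s * v).toNNReal := by
            rw [← lintegral_const_mul _ (by fun_prop)]
            refine lintegral_congr fun w => ?_
            rw [← ENNReal.ofReal_mul hΓ2p.le, mul_comm, div_eq_mul_inv]
        _ ≤ ENNReal.ofReal Γ2 * ENNReal.ofReal (auxκ d * ((ν j)⁻¹) ^ (-(7/8*d)) *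
              (((2 * s * t)⁻¹) ^ (-(d/8)) * ((s * v) ^ (-(d/8)) * (1 / (1 - d/4))))) := by
            gcongr
            exact aux_gauss_neg2 _ _ _ _ hsv (by positivity) (by positivity) hd (by linarith)
        _ ≤ ENNReal.ofReal Γ2 * ENNReal.ofReal (H * (xq + Lq * t ^ (d/8)) * ν j ^ (7/8*d)) := by
            refine mul_le_mul_right (ENNReal.ofReal_le_ofReal ?_) _
            exact aux_neg_real hd hd1 hL0 hv0 hv1 hs ht hxj hνj
        _ = _ := by
            rw [← ENNReal.ofReal_mul hΓ2p.le, ← ENNReal.ofReal_mul hW0, hW]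
            congr 1; ring
    have hmeas : Measurable fun ν : Fin p → ℝ =>
        ∏ j, ENNReal.ofReal (igDens 1 (1 + (x j)⁻¹) (ν j)) := by
      have := aux_ig_meas
      fun_prop
    calc _ ≤ ∫⁻ ν in Set.univ.pi (fun _ : Fin p => Set.Ioi (0 : ℝ)),
          ENNReal.ofReal W * (ENNReal.ofReal (ν j ^ (7/8*d)) *
          ∏ j, ENNReal.ofReal (igDens 1 (1 + (x j)⁻¹) (ν j))) := by
          refine setLIntegral_mono' hmp fun ν hν => ?_
          rw [← mul_assoc]
          gcongr
          calc _ ≤ ∫⁻ s in Set.Ioi (0:ℝ),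
                (ENNReal.ofReal W * ENNReal.ofReal (ν j ^ (7/8*d))) *
                ENNReal.ofReal (igDens α (hsR n p X y b t x) s) := by
                refine setLIntegral_mono' measurableSet_Ioi fun s hs => ?_
                gcongr
                exact hin ν hν s hs
            _ = _ := by
                rw [lintegral_const_mul _ (aux_ig_meas _ _).ennreal_ofReal, aux_ig_mass hαp hrp,
                  mul_one]
      _ = ENNReal.ofReal W * ENNReal.ofReal ((1 + (x j)⁻¹) ^ (7/8*d) * Γ1) := by
          rw [lintegral_const_mul (f := fun ν : Fin p → ℝ => ENNReal.ofReal (ν j ^ (7/8*d)) *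
            ∏ j, ENNReal.ofReal (igDens 1 (1 + (x j)⁻¹) (ν j))) _
            (Measurable.mul (by fun_prop) hmeas),
            aux_nu hx j (by linarith), hΓ1]
      _ ≤ _ := by
          rw [← ENNReal.ofReal_mul hW0]
          refine ENNReal.ofReal_le_ofReal ?_
          have h1 : (1 + (x j)⁻¹) ^ (7/8*d) ≤ 1 + xt := by
            refine (Real.rpow_add_le_add_rpow (by norm_num) (by positivity) (by positivity)
              (by linarith)).trans_eq ?_
            rw [Real.one_rpow, Real.inv_rpow hxj.le, ← Real.rpow_neg hxj.le, hxt]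
          calc W * ((1 + (x j)⁻¹) ^ (7/8*d) * Γ1) ≤ W * ((1 + xt) * Γ1) :=
                mul_le_mul_of_nonneg_left (mul_le_mul_of_nonneg_right h1 hΓ1p.le) hW0
            _ = _ := by rw [hW]; ring
  set Q : ℝ := Γ2 * (Γ1 * H) * (1 + xt) with hQ
  have hQ0 : 0 ≤ Q := mul_nonneg (mul_pos hΓ2p (mul_pos hΓ1p hHp)).le (by linarith)
  calc _ ≤ ∫⁻ t in Set.Ioi (0:ℝ), (ENNReal.ofReal (Q * xq) + ENNReal.ofReal (Q * Lq) *
        ENNReal.ofReal (t ^ (d/8))) *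
        ENNReal.ofReal (hsTauDens n p X y a b g x t /
          ∫ u in Set.Ioi (0:ℝ), hsTauDens n p X y a b g x u) := by
        refine setLIntegral_mono' measurableSet_Ioi fun t ht => ?_
        rcases lt_or_ge t T with h | h
        · have : hsTauDens n p X y a b g x t = 0 := by simp [hsTauDens, hgT t h]
          simp [this]
        · gcongr
          refine (key t ht h).trans ?_
          refine le_trans (ENNReal.ofReal_le_ofReal (le_of_eq ?_))
            (aux_ofReal_add_mul (mul_nonneg hQ0 hLq0))
          ring
    _ ≤ ENNReal.ofReal (Q * xq + Q * Lq * M) := by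
        refine aux_avg _ ((aux_meas_tau X y a b x hg).div_const _).ennreal_ofReal (by fun_prop)
          hmass.le (mul_nonneg hQ0 hxq0.le) (mul_nonneg hQ0 hLq0) hM hmom
    _ = _ := by congr 1; ring


lemma aux_mtd_congr {n p : ℕ} (X : Matrix (Fin n) (Fin p) ℝ) (y : Fin n → ℝ) (a b : ℝ)
    {g π₁ : ℝ → ℝ} (h : ∀ᵐ t ∂(volume.restrict (Set.Ioi (0:ℝ))), π₁ t = g t)
    (x x' : Fin p → ℝ) : hsMTD n p X y a b π₁ x x' = hsMTD n p X y a b g x x' := by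
  have hf : ∀ᵐ t ∂(volume.restrict (Set.Ioi (0:ℝ))),
      hsTauDens n p X y a b π₁ x t = hsTauDens n p X y a b g x t := h.mono fun t ht => by
    simp only [hsTauDens, ht]
  unfold hsMTD
  rw [integral_congr_ae hf]
  exact integral_congr_ae (hf.mono fun t ht => by simp only [ht])

lemma aux_prior {πτ : ℝ → ℝ} (hπ_nonneg : ∀ t, 0 ≤ πτ t)
    (hπ_prob : ∫ t in Set.Ioi (0 : ℝ), πτ t = 1)
    {T e : ℝ} (hT : 0 < T)
    (hvanish : ∀ t ∈ Set.Ioo (0 : ℝ) T, πτ t = 0)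
    (hmom : IntegrableOn (fun t => t ^ e * πτ t) (Set.Ioi T)) :
    ∃ g : ℝ → ℝ, Measurable g ∧ (∀ t, 0 ≤ g t) ∧ (∀ t, t < T → g t = 0) ∧
      (∀ᵐ t ∂(volume.restrict (Set.Ioi (0:ℝ))), πτ t = g t) ∧
      (∫ t in Set.Ioi (0 : ℝ), g t = 1) ∧ IntegrableOn (fun t => t ^ e * g t) (Set.Ioi 0) := by
  have hπi : IntegrableOn πτ (Set.Ioi 0) := by
    by_contra h
    rw [integral_undef h] at hπ_prob
    norm_num at hπ_prob
  set m := hπi.aestronglyMeasurable.mk with hm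
  have hmm : Measurable m := hπi.aestronglyMeasurable.stronglyMeasurable_mk.measurable
  have hme : ∀ᵐ t ∂(volume.restrict (Set.Ioi (0:ℝ))), πτ t = m t :=
    hπi.aestronglyMeasurable.ae_eq_mk
  set g : ℝ → ℝ := fun t => if t < T then 0 else max (m t) 0 with hg
  have hge : ∀ᵐ t ∂(volume.restrict (Set.Ioi (0:ℝ))), πτ t = g t := by
    filter_upwards [hme, ae_restrict_mem measurableSet_Ioi] with t h1 h2
    by_cases h : t < T
    · simp only [hg, h, if_true]
      exact hvanish t ⟨h2, h⟩
    · simp only [hg, h, if_false]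
      rw [← h1, max_eq_left (hπ_nonneg t)]
  have hg0 : ∀ t, t < T → g t = 0 := fun t ht => by simp [hg, ht]
  refine ⟨g, Measurable.ite measurableSet_Iio measurable_const (hmm.max measurable_const),
    fun t => ?_, hg0, hge, ?_, ?_⟩
  · simp only [hg]; split_ifs <;> simp
  · rw [← hπ_prob]
    exact (integral_congr_ae hge).symm
  · have h1 : IntegrableOn (fun t => t ^ e * g t) (Set.Ioi T) := by
      refine hmom.congr ?_
      have : ∀ᵐ t ∂(volume.restrict (Set.Ioi T)), πτ t = g t :=
        ae_restrict_of_ae_restrict_of_subset (Set.Ioi_subset_Ioi hT.le) hge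
      exact this.mono fun t ht => by simp only [ht]
    refine h1.of_ae_diff_eq_zero measurableSet_Ioi.nullMeasurableSet ?_
    have hne : ∀ᵐ t : ℝ, t ≠ T := by
      simp [ae_iff]
    filter_upwards [hne] with t ht hmem
    have : t < T := lt_of_le_of_ne (not_lt.1 hmem.2) ht
    simp [hg0 t this]

lemma aux_neg_absorb {d G N : ℝ} (hd : 0 < d) (hG : 0 < G) (hG1 : G < 1) (hN : 0 ≤ N) :
    ∃ C, 0 ≤ C ∧ ∀ x : ℝ, 0 < x → G * (1 + x ^ (-(7/8*d))) * (x ^ (-(d/8)) + N) ≤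
      (1 + G) / 2 * x ^ (-d) + C := by
  obtain ⟨C1, h1, H1⟩ := aux_absorb (q := 7/8*d) (d := d) (M := G * N) (ε := (1 - G)/4)
    (by positivity) (by linarith) (by positivity) (by linarith)
  obtain ⟨C2, h2, H2⟩ := aux_absorb (q := d/8) (d := d) (M := G) (ε := (1 - G)/4)
    (by positivity) (by linarith) hG.le (by linarith)
  refine ⟨C1 + C2 + G * N, by positivity, fun x hx => ?_⟩
  have := H1 x hx
  have := H2 x hx
  have e : x ^ (-(7/8*d)) * x ^ (-(d/8)) = x ^ (-d) := by
    rw [← Real.rpow_add hx]; congr 1; ring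
  have : G * (1 + x ^ (-(7/8*d))) * (x ^ (-(d/8)) + N) =
    G * x ^ (-(d/8)) + G * N + G * (x ^ (-(7/8*d)) * x ^ (-(d/8))) + G * N * x ^ (-(7/8*d)) := by
    ring
  rw [this, e]
  linarith


/-- (Geometric drift condition for the Horseshoe Gibbs
sampler.)  If the prior `π_τ` vanishes on `(0, T)` for some `T > 0` and has a
finite `δ/2`-th moment for some `δ ∈ (0.00162, 0.22176)`, then there exist
`δ₀, δ₁ ∈ (0,1)`, `γ* ∈ (0,1)` and `b* < ∞` such that for all
`x ∈ (0,∞)^p`, `∫ k(x,·)V ≤ γ* V(x) + b*` with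
`V(x) = Σⱼ x_j^{δ₀/2} + Σⱼ x_j^{−δ₁/2}`. -/
theorem stmt13 (n p : ℕ) (hn : 0 < n) (hp : 0 < p)
    (X : Matrix (Fin n) (Fin p) ℝ) (y : Fin n → ℝ)
    (a b : ℝ) (ha : 0 < a) (hb : 0 < b)
    (πτ : ℝ → ℝ) (hπ_nonneg : ∀ t, 0 ≤ πτ t)
    (hπ_prob : ∫ t in Set.Ioi (0 : ℝ), πτ t = 1)
    (T δ : ℝ) (hT : 0 < T) (hδ : δ ∈ Set.Ioo (0.00162 : ℝ) 0.22176)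
    (hvanish : ∀ t ∈ Set.Ioo (0 : ℝ) T, πτ t = 0)
    (hmom : IntegrableOn (fun t => t ^ (δ / 2) * πτ t) (Set.Ioi T)) :
    ∃ δ0 ∈ Set.Ioo (0 : ℝ) 1, ∃ δ1 ∈ Set.Ioo (0 : ℝ) 1,
      ∃ γ ∈ Set.Ioo (0 : ℝ) 1, ∃ bst : ℝ,
        ∀ x : Fin p → ℝ, (∀ j, 0 < x j) →
          (∫⁻ x' in Set.univ.pi (fun _ : Fin p => Set.Ioi (0 : ℝ)),
            ENNReal.ofReal (hsMTD n p X y a b πτ x x' *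
              (∑ j, (x' j) ^ (δ0 / 2) + ∑ j, (x' j) ^ (-δ1 / 2)))) ≤
          ENNReal.ofReal
            (γ * (∑ j, (x j) ^ (δ0 / 2) + ∑ j, (x j) ^ (-δ1 / 2)) + bst) := by
  obtain ⟨hδ1, hδ2⟩ := hδ
  have hδ0 : 0 < δ := lt_trans (by norm_num) hδ1
  obtain ⟨g, hg, hg0, hgT, hge, hg1, hgm⟩ :=
    aux_prior (e := δ/2) hπ_nonneg hπ_prob hT hvanish hmom
  obtain ⟨c, hc, hc1, hcG⟩ := aux_const_c (m := 1/2) (by norm_num)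
  obtain ⟨d, hd, hd1, hdG⟩ := aux_const_d (m := min (1/2) δ) (lt_min (by norm_num) hδ0)
  have hd2 : d < 1/2 := hd1.trans_le (min_le_left _ _)
  have hd3 : d < δ := hd1.trans_le (min_le_right _ _)
  obtain ⟨M, hM0, hM⟩ := aux_tau X y ha hb hg hg0 hg1 (q := d/8) (e := δ/2) (by positivity)
    (by linarith) hgm
  obtain ⟨K, hK0, hK⟩ := aux_pos X y ha hb hT hc hc1
  set G : ℝ := Real.Gamma (1 + d) * (Real.Gamma (1 - 7/8*d) * (auxκ d *
      ((2:ℝ) ^ (d/8) * (1 / (1 - d/4))))) with hG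
  have hGp : 0 < G := by
    have h1 : 0 < 1 - d/4 := by linarith
    have h2 : 0 < auxκ d := by unfold auxκ; positivity
    have h3 := Real.Gamma_pos_of_pos (show 0 < 1 + d by linarith)
    have h4 := Real.Gamma_pos_of_pos (show 0 < 1 - 7/8*d by linarith)
    positivity
  have hLj : ∀ j : Fin p, 0 ≤ (Xᵀ * X) j j := fun j => by
    rw [Matrix.mul_apply]
    exact Finset.sum_nonneg fun i _ => mul_self_nonneg _
  choose Cn hCn0 hCn using fun j : Fin p => aux_neg_absorb (N := ((Xᵀ * X) j j) ^ (d/8) * M) hd hGp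
    hdG (mul_nonneg (Real.rpow_nonneg (hLj j) _) hM0)
  set γ1 : ℝ := Real.Gamma (1 - c) * 2 ^ (-c) with hγ1
  have hγ1p : 0 < γ1 := by
    have := Real.Gamma_pos_of_pos (show 0 < 1 - c by linarith)
    positivity
  clear_value G γ1
  refine ⟨2 * c, ⟨by linarith, by linarith⟩, 2 * d, ⟨by linarith, by linarith⟩,
    max γ1 ((1 + G)/2), ⟨lt_max_of_lt_left hγ1p, max_lt hcG (by linarith)⟩,
    ∑ j, (K + Cn j), fun x hx => ?_⟩
  rw [show 2 * c / 2 = c by ring, show -(2 * d) / 2 = -d by ring]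
  obtain ⟨hZ, hmass, hmo⟩ := hM x hx
  have hmp : MeasurableSet (Set.univ.pi (fun _ : Fin p => Set.Ioi (0 : ℝ))) :=
    MeasurableSet.univ_pi fun _ => measurableSet_Ioi
  have hf : ∀ t, 0 < t → 0 ≤ hsTauDens n p X y a b g x t := fun t ht => by
    obtain ⟨l, hl0, hl⟩ := aux_det X hx
    have h1 := (aux_hsR X y b ht hx).1
    have h2 : 0 ≤ hsR n p X y b t x := hb.le.trans h1
    have h3 : 0 ≤ ∏ i, (1 + t * l i) := Finset.prod_nonneg fun i _ => by
      have := mul_nonneg ht.le (hl0 i); linarith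
    unfold hsTauDens
    rw [hl]
    exact mul_nonneg (mul_nonneg (Real.rpow_nonneg h2 _) (Real.rpow_nonneg h3 _)) (hg0 t)
  have hKm := (auxK_swap X y a b hg x).1
  calc _ ≤ ∫⁻ x' in Set.univ.pi (fun _ : Fin p => Set.Ioi (0 : ℝ)),
        (∑ j, auxK X y a b g x x' * ENNReal.ofReal (x' j ^ c) +
          ∑ j, auxK X y a b g x x' * ENNReal.ofReal (x' j ^ (-d))) := by
        refine setLIntegral_mono' hmp fun x' hx' => ?_
        have hx' : ∀ j, 0 < x' j := fun j => hx' j (Set.mem_univ j)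
        have n1 : ∀ j ∈ Finset.univ, 0 ≤ x' j ^ c := fun j _ => Real.rpow_nonneg (hx' j).le _
        have n2 : ∀ j ∈ Finset.univ, 0 ≤ x' j ^ (-d) := fun j _ => Real.rpow_nonneg (hx' j).le _
        rw [ENNReal.ofReal_mul' (add_nonneg (Finset.sum_nonneg n1) (Finset.sum_nonneg n2)),
          ENNReal.ofReal_add (Finset.sum_nonneg n1) (Finset.sum_nonneg n2),
          ENNReal.ofReal_sum_of_nonneg n1, ENNReal.ofReal_sum_of_nonneg n2,
          ← Finset.mul_sum, ← Finset.mul_sum, ← mul_add, aux_mtd_congr X y a b hge]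
        gcongr
        exact auxK_bound X y ha hb hx hx' hf hZ
    _ = (∑ j, ∫⁻ x' in Set.univ.pi (fun _ : Fin p => Set.Ioi (0 : ℝ)),
          auxK X y a b g x x' * ENNReal.ofReal (x' j ^ c)) +
        ∑ j, ∫⁻ x' in Set.univ.pi (fun _ : Fin p => Set.Ioi (0 : ℝ)),
          auxK X y a b g x x' * ENNReal.ofReal (x' j ^ (-d)) := by
        rw [lintegral_add_left (by fun_prop), lintegral_finsetSum _ (fun j _ => by fun_prop),
          lintegral_finsetSum _ (fun j _ => by fun_prop)]
    _ ≤ ∑ j, ENNReal.ofReal (γ1 * x j ^ c + K) +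
        ∑ j, ENNReal.ofReal ((1 + G)/2 * x j ^ (-d) + Cn j) := by
        refine add_le_add (Finset.sum_le_sum fun j _ => ?_) (Finset.sum_le_sum fun j _ => ?_)
        · exact hK g hg hgT x hx hmass j
        · refine (aux_neg X y ha hb hT hd hd2 hM0 hg hgT hx hmass hmo j).trans ?_
          rw [← hG]
          exact ENNReal.ofReal_le_ofReal (hCn j (x j) (hx j))
    _ ≤ _ := by
        have p1 : ∀ j, 0 ≤ x j ^ c := fun j => Real.rpow_nonneg (hx j).le _
        have p2 : ∀ j, 0 ≤ x j ^ (-d) := fun j => Real.rpow_nonneg (hx j).le _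
        have q1 : ∀ j ∈ Finset.univ, 0 ≤ γ1 * x j ^ c + K := fun j _ =>
          add_nonneg (mul_nonneg hγ1p.le (p1 j)) hK0
        have q2 : ∀ j ∈ Finset.univ, 0 ≤ (1 + G)/2 * x j ^ (-d) + Cn j := fun j _ =>
          add_nonneg (mul_nonneg (by linarith) (p2 j)) (hCn0 j)
        rw [← ENNReal.ofReal_sum_of_nonneg q1, ← ENNReal.ofReal_sum_of_nonneg q2,
          ← ENNReal.ofReal_add (Finset.sum_nonneg q1) (Finset.sum_nonneg q2)]
        refine ENNReal.ofReal_le_ofReal ?_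
        rw [mul_add, Finset.mul_sum, Finset.mul_sum, ← Finset.sum_add_distrib,
          ← Finset.sum_add_distrib, ← Finset.sum_add_distrib]
        refine Finset.sum_le_sum fun j _ => ?_
        have r1 := mul_le_mul_of_nonneg_right (le_max_left γ1 ((1 + G)/2)) (p1 j)
        have r2 := mul_le_mul_of_nonneg_right (le_max_right γ1 ((1 + G)/2)) (p2 j)
        linarith
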